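/- arXiv:1801.01028 — 2 statements merged into one kernel-verified Lean document; each statement's English description precedes it below -/
import Mathlib

section
/- Let r₀ := 1/(9√d). There exist a bounded C³ function Ψ̃ : ℝ^d → ℝ, a constant C > 0 and a continuous function ξ̃ : ℝ^d → [0,1] whose support is contained in the cube Q_{r₀}, such that for every 0 < r ≤ 9√d: (i) P⁻(D²Ψ̃)(x) + P⁻_{K,r}(Ψ̃)(x) − C₀|DΨ̃(x)| ≥ −Cξ̃(x) for all x ∈ ℝ^d; (ii) Ψ̃ ≤ 0 outside the unit ball B₁; (iii) Ψ̃ ≥ 2 on the cube Q_{3r₀}. -/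
open MeasureTheory Metric Set
open scoped RealInnerProductSpace ENNReal

noncomputable section

/-- `d`-dimensional Euclidean space. -/
abbrev Ed (d : ℕ) : Type := EuclideanSpace ℝ (Fin d)

/-- A real-valued function on `ℝ^d` is bounded. -/
def IsBddFun {d : ℕ} (φ : Ed d → ℝ) : Prop := ∃ M, ∀ x, |φ x| ≤ M

/-- The open cube of half side length `δ` centered at `x`. -/
def cubeAt {d : ℕ} (x : Ed d) (δ : ℝ) : Set (Ed d) := {y | ∀ i, |y i - x i| < δ}

/-- The open cube `Q_δ = (-δ, δ)^d`. -/
def cube (d : ℕ) (δ : ℝ) : Set (Ed d) := cubeAt 0 δ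

/-- Hessian matrix of `φ` at `x` (matrix of second derivatives). -/
def hess {d : ℕ} (φ : Ed d → ℝ) (x : Ed d) : Matrix (Fin d) (Fin d) ℝ :=
  Matrix.of fun i j =>
    iteratedFDeriv ℝ 2 φ x ![EuclideanSpace.single i (1 : ℝ), EuclideanSpace.single j (1 : ℝ)]

/-- Symmetric matrices `A` with `λ I ≤ A ≤ Λ I`. -/
def ellipticSet (lam Lam : ℝ) (d : ℕ) : Set (Matrix (Fin d) (Fin d) ℝ) :=
  {A | A.IsSymm ∧ (A - lam • (1 : Matrix (Fin d) (Fin d) ℝ)).PosSemidef ∧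
      (Lam • (1 : Matrix (Fin d) (Fin d) ℝ) - A).PosSemidef}

/-- The Pucci maximal operator `P⁺`. -/
def pucciPlus {d : ℕ} (lam Lam : ℝ) (X : Matrix (Fin d) (Fin d) ℝ) : ℝ :=
  sSup ((fun A => (A * X).trace) '' ellipticSet lam Lam d)

/-- The Pucci minimal operator `P⁻`. -/
def pucciMinus {d : ℕ} (lam Lam : ℝ) (X : Matrix (Fin d) (Fin d) ℝ) : ℝ :=
  sInf ((fun A => (A * X).trace) '' ellipticSet lam Lam d)

/-- The Lévy kernel condition: `K ≥ 0` measurable with `∫ min(|z|²,1) K(z) dz < ∞`. -/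
def KernCond {d : ℕ} (K : Ed d → ℝ) : Prop :=
  Measurable K ∧ (∀ z, 0 ≤ K z) ∧ Integrable (fun z : Ed d => min (‖z‖ ^ 2) 1 * K z)

/-- The rescaled kernel `K_r(z) = r^{d+2} K(rz)`. -/
def Kresc {d : ℕ} (K : Ed d → ℝ) (r : ℝ) (z : Ed d) : ℝ := r ^ (d + 2) * K (r • z)

/-- The second-order increment `u(x+z) − u(x) − 1_{B_{1/r}}(z) Du(x)·z`. -/
def deltaOp {d : ℕ} (φ : Ed d → ℝ) (r : ℝ) (x z : Ed d) : ℝ :=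
  φ (x + z) - φ x - (Metric.ball (0 : Ed d) (1 / r)).indicator (fun w => ⟪gradient φ x, w⟫) z

/-- The maximal nonlocal Pucci operator `P⁺_{K,r}`. -/
def nlPlus {d : ℕ} (K : Ed d → ℝ) (r : ℝ) (φ : Ed d → ℝ) (x : Ed d) : ℝ :=
  ∫ z, max (deltaOp φ r x z) 0 * Kresc K r z

/-- The minimal nonlocal Pucci operator `P⁻_{K,r}`. -/
def nlMinus {d : ℕ} (K : Ed d → ℝ) (r : ℝ) (φ : Ed d → ℝ) (x : Ed d) : ℝ :=
  -∫ z, max (-deltaOp φ r x z) 0 * Kresc K r z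

/-- Viscosity supersolution of `−P⁻(D²u) − P⁻_{K,r}(u) + C₀ r |Du| ≥ f` in `O`. -/
def SupersolExtremal {d : ℕ} (lam Lam C0 r : ℝ) (K f : Ed d → ℝ) (O : Set (Ed d))
    (u : Ed d → ℝ) : Prop :=
  ∀ φ : Ed d → ℝ, ContDiff ℝ 2 φ → IsBddFun φ → ∀ x ∈ O, (∀ y, φ y ≤ u y) → u x = φ x →
    f x ≤ -pucciMinus lam Lam (hess φ x) - nlMinus K r φ x + C0 * r * ‖gradient φ x‖

/-- Viscosity subsolution of `P⁺(D²u) + P⁺_K(u) + C₀|Du| ≥ g` in `O`. -/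
def SubsolPlus {d : ℕ} (lam Lam C0 : ℝ) (K g : Ed d → ℝ) (O : Set (Ed d)) (u : Ed d → ℝ) : Prop :=
  ∀ φ : Ed d → ℝ, ContDiff ℝ 2 φ → IsBddFun φ → ∀ x ∈ O, (∀ y, u y ≤ φ y) → u x = φ x →
    g x ≤ pucciPlus lam Lam (hess φ x) + nlPlus K 1 φ x + C0 * ‖gradient φ x‖

/-- Viscosity supersolution of `P⁻(D²u) + P⁻_K(u) − C₀|Du| ≤ g` in `O`. -/
def SupersolMinus {d : ℕ} (lam Lam C0 : ℝ) (K g : Ed d → ℝ) (O : Set (Ed d)) (u : Ed d → ℝ) : Prop :=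
  ∀ φ : Ed d → ℝ, ContDiff ℝ 2 φ → IsBddFun φ → ∀ x ∈ O, (∀ y, φ y ≤ u y) → u x = φ x →
    pucciMinus lam Lam (hess φ x) + nlMinus K 1 φ x - C0 * ‖gradient φ x‖ ≤ g x

/-- Negative part `f⁻ = −min{f,0}`. -/
def nPart {d : ℕ} (f : Ed d → ℝ) : Ed d → ℝ := fun x => max (-f x) 0

/-- Positive part `f⁺ = max{f,0}`. -/
def pPart {d : ℕ} (f : Ed d → ℝ) : Ed d → ℝ := fun x => max (f x) 0

/-- The `L^p` norm of `f` on a set `S`. -/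
def LnormOn {d : ℕ} (p : ℝ) (S : Set (Ed d)) (f : Ed d → ℝ) : ℝ :=
  (∫ x in S, |f x| ^ p) ^ (1 / p)

/-- The nonlocal contact set `Γ^{n,−}_O(v)`. -/
def nContact {d : ℕ} (O : Set (Ed d)) (v : Ed d → ℝ) : Set (Ed d) :=
  {x | x ∈ O ∧ v x < sInf (v '' Oᶜ) ∧
      ∃ p : Ed d, ∀ y, Metric.infDist y O < Metric.diam O → v x + ⟪p, y - x⟫ ≤ v y}

/-- The set `G^u_M` of points where `u` is touched from below by a paraboloid of opening `M`. -/
def GSet {d : ℕ} (u : Ed d → ℝ) (M : ℝ) : Set (Ed d) :=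
  {x | ∃ ρ > 0, ∃ A C : ℝ, ∃ B : Ed d, |A| + ‖B‖ + |C| ≤ M ∧ u x = A ∧
      ∀ y ∈ Metric.ball x ρ, A + ⟪B, y - x⟫ - C / 2 * ‖y - x‖ ^ 2 ≤ u y}

/-- The bad set `B^u_M`. -/
def BSet {d : ℕ} (u : Ed d → ℝ) (M : ℝ) : Set (Ed d) := (GSet u M)ᶜ

/-- Upper semicontinuous envelope `u*`. -/
def usEnv {d : ℕ} (u : Ed d → ℝ) (x : Ed d) : ℝ :=
  ⨅ ρ : {ρ : ℝ // 0 < ρ}, ⨆ y : {y : Ed d // ‖y - x‖ ≤ ρ.1}, u y.1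

/-- Lower semicontinuous envelope `u_*`. -/
def lsEnv {d : ℕ} (u : Ed d → ℝ) (x : Ed d) : ℝ :=
  ⨆ ρ : {ρ : ℝ // 0 < ρ}, ⨅ y : {y : Ed d // ‖y - x‖ ≤ ρ.1}, u y.1

/-- A modulus of continuity. -/
def IsModulus (m : ℝ → ℝ) : Prop :=
  (∀ t, 0 ≤ m t) ∧ Monotone m ∧ m 0 = 0 ∧ ContinuousAt m 0

/-- The uniform exterior ball condition. -/
def ExtBallCond {d : ℕ} (Ω : Set (Ed d)) : Prop :=
  ∃ ρ > 0, ∀ ξ ∈ frontier Ω, ∃ y ∈ Ωᶜ, Metric.ball y ρ ⊆ Ωᶜ ∧ ξ ∈ Metric.sphere y ρ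

section HJBI

variable {d : ℕ} {𝒜 ℬ : Type}

/-- The linear nonlocal operator `I_{ab}[x, φ]`. -/
def Iop (N : 𝒜 → ℬ → Ed d → Ed d → ℝ) (a : 𝒜) (b : ℬ) (φ : Ed d → ℝ) (x : Ed d) : ℝ :=
  ∫ z, (φ (x + z) - φ x -
      (Metric.ball (0 : Ed d) 1).indicator (fun w => ⟪gradient φ x, w⟫) z) * N a b x z

/-- The HJBI operator evaluated at `φ`, with the zeroth order slot evaluated at `s`. -/
def HJBIat (aM : 𝒜 → ℬ → Ed d → Matrix (Fin d) (Fin d) ℝ) (bV : 𝒜 → ℬ → Ed d → Ed d)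
    (cF fF : 𝒜 → ℬ → Ed d → ℝ) (N : 𝒜 → ℬ → Ed d → Ed d → ℝ)
    (φ : Ed d → ℝ) (s : ℝ) (x : Ed d) : ℝ :=
  ⨆ a, ⨅ b, (-(aM a b x * hess φ x).trace - Iop N a b φ x +
    ⟪bV a b x, gradient φ x⟫ + cF a b x * s + fF a b x)

/-- The HJBI operator `ℐφ(x)`. -/
def HJBIop (aM : 𝒜 → ℬ → Ed d → Matrix (Fin d) (Fin d) ℝ) (bV : 𝒜 → ℬ → Ed d → Ed d)
    (cF fF : 𝒜 → ℬ → Ed d → ℝ) (N : 𝒜 → ℬ → Ed d → Ed d → ℝ)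
    (φ : Ed d → ℝ) (x : Ed d) : ℝ :=
  HJBIat aM bV cF fF N φ (φ x) x

/-- Viscosity subsolution of `ℐu = 0` in `Ω` (test function formulation). -/
def SubsolHJBI (aM : 𝒜 → ℬ → Ed d → Matrix (Fin d) (Fin d) ℝ) (bV : 𝒜 → ℬ → Ed d → Ed d)
    (cF fF : 𝒜 → ℬ → Ed d → ℝ) (N : 𝒜 → ℬ → Ed d → Ed d → ℝ) (Ω : Set (Ed d))
    (u : Ed d → ℝ) : Prop :=
  ∀ φ : Ed d → ℝ, ContDiff ℝ 2 φ → IsBddFun φ → ∀ x ∈ Ω, (∀ y, u y ≤ φ y) → u x = φ x →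
    HJBIop aM bV cF fF N φ x ≤ 0

/-- Viscosity supersolution of `ℐu = 0` in `Ω` (test function formulation). -/
def SupersolHJBI (aM : 𝒜 → ℬ → Ed d → Matrix (Fin d) (Fin d) ℝ) (bV : 𝒜 → ℬ → Ed d → Ed d)
    (cF fF : 𝒜 → ℬ → Ed d → ℝ) (N : 𝒜 → ℬ → Ed d → Ed d → ℝ) (Ω : Set (Ed d))
    (u : Ed d → ℝ) : Prop :=
  ∀ φ : Ed d → ℝ, ContDiff ℝ 2 φ → IsBddFun φ → ∀ x ∈ Ω, (∀ y, φ y ≤ u y) → u x = φ x →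
    0 ≤ HJBIop aM bV cF fF N φ x

/-- Uniform ellipticity of the HJBI operator `ℐ`. -/
def UnifElliptic (lam Lam C0 : ℝ) (K : Ed d → ℝ) (Ω : Set (Ed d))
    (aM : 𝒜 → ℬ → Ed d → Matrix (Fin d) (Fin d) ℝ) (bV : 𝒜 → ℬ → Ed d → Ed d)
    (cF fF : 𝒜 → ℬ → Ed d → ℝ) (N : 𝒜 → ℬ → Ed d → Ed d → ℝ) : Prop :=
  ∃ m : ℝ → ℝ, IsModulus m ∧
    ∀ r s : ℝ, ∀ x ∈ Ω, ∀ φ ψ : Ed d → ℝ,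
      ContDiff ℝ 2 φ → IsBddFun φ → ContDiff ℝ 2 ψ → IsBddFun ψ →
      (pucciMinus lam Lam (hess (fun y => φ y - ψ y) x) + nlMinus K 1 (fun y => φ y - ψ y) x -
          C0 * ‖gradient (fun y => ψ y - φ y) x‖ - m |r - s| ≤
        HJBIat aM bV cF fF N ψ r x - HJBIat aM bV cF fF N φ s x) ∧
      (HJBIat aM bV cF fF N ψ r x - HJBIat aM bV cF fF N φ s x ≤
        pucciPlus lam Lam (hess (fun y => φ y - ψ y) x) + nlPlus K 1 (fun y => φ y - ψ y) x +
          C0 * ‖gradient (fun y => ψ y - φ y) x‖ + m |r - s|)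

/-- Boundedness of the coefficient families, uniformly in `a, b`. -/
def FamiliesBdd (Ω : Set (Ed d)) (aM : 𝒜 → ℬ → Ed d → Matrix (Fin d) (Fin d) ℝ)
    (bV : 𝒜 → ℬ → Ed d → Ed d) (cF fF : 𝒜 → ℬ → Ed d → ℝ) : Prop :=
  ∃ Cb : ℝ, ∀ a b, ∀ x ∈ Ω, (∀ i j, |aM a b x i j| ≤ Cb) ∧ ‖bV a b x‖ ≤ Cb ∧
      |cF a b x| ≤ Cb ∧ |fF a b x| ≤ Cb

/-- Uniform continuity of the coefficient families with a common modulus, uniformly in `a, b, z`. -/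
def FamiliesUC (Ω : Set (Ed d)) (aM : 𝒜 → ℬ → Ed d → Matrix (Fin d) (Fin d) ℝ)
    (bV : 𝒜 → ℬ → Ed d → Ed d) (cF fF : 𝒜 → ℬ → Ed d → ℝ)
    (N : 𝒜 → ℬ → Ed d → Ed d → ℝ) : Prop :=
  ∃ m₀ : ℝ → ℝ, IsModulus m₀ ∧ ∀ a b, ∀ x ∈ Ω, ∀ y ∈ Ω,
      (∀ i j, |aM a b x i j - aM a b y i j| ≤ m₀ ‖x - y‖) ∧
      ‖bV a b x - bV a b y‖ ≤ m₀ ‖x - y‖ ∧ |cF a b x - cF a b y| ≤ m₀ ‖x - y‖ ∧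
      |fF a b x - fF a b y| ≤ m₀ ‖x - y‖ ∧ ∀ z, |N a b x z - N a b y z| ≤ m₀ ‖x - y‖

end HJBI

/-- The Gaussian barrier. -/
def gPsi {d : ℕ} (c g : ℝ) (x : Ed d) : ℝ := c * (Real.exp (-g * ‖x‖ ^ 2) - Real.exp (-g))

lemma gPsi_contDiff {d : ℕ} (c g : ℝ) (n : WithTop ℕ∞) : ContDiff ℝ n (gPsi (d := d) c g) := by
  unfold gPsi
  have h : ContDiff ℝ n (fun x : Ed d => ‖x‖ ^ 2) := contDiff_norm_sq ℝ
  exact contDiff_const.mul (((contDiff_const.mul h).exp).sub contDiff_const)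

lemma gPsi_hasFDerivAt {d : ℕ} (c g : ℝ) (x : Ed d) :
    HasFDerivAt (gPsi (d := d) c g)
      ((-2 * g * c * Real.exp (-g * ‖x‖ ^ 2)) • innerSL ℝ x) x := by
  have h : HasFDerivAt (fun x : Ed d => ‖x‖ ^ 2) (2 • innerSL ℝ x) x :=
    (hasStrictFDerivAt_norm_sq x).hasFDerivAt
  have h2 := (((h.const_mul (-g)).exp).sub_const (Real.exp (-g))).const_mul c
  refine h2.congr_fderiv ?_
  ext z
  simp
  ring

lemma gPsi_gradient {d : ℕ} (c g : ℝ) (x : Ed d) :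
    gradient (gPsi (d := d) c g) x = (-2 * g * c * Real.exp (-g * ‖x‖ ^ 2)) • x := by
  apply HasGradientAt.gradient
  rw [hasGradientAt_iff_hasFDerivAt]
  refine (gPsi_hasFDerivAt c g x).congr_fderiv ?_
  ext z
  simp [inner_smul_left]

lemma gPsi_hess {d : ℕ} (c g : ℝ) (x : Ed d) (i j : Fin d) :
    hess (gPsi (d := d) c g) x i j =
      c * Real.exp (-g * ‖x‖ ^ 2) * (4 * g ^ 2 * (x i * x j) - 2 * g * (if i = j then 1 else 0)) := by
  have h1 : fderiv ℝ (gPsi (d := d) c g) =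
      fun x => (-2 * g * c * Real.exp (-g * ‖x‖ ^ 2)) • innerSL ℝ x :=
    funext fun x => (gPsi_hasFDerivAt c g x).fderiv
  have h : HasFDerivAt (fun x : Ed d => ‖x‖ ^ 2) (2 • innerSL ℝ x) x :=
    (hasStrictFDerivAt_norm_sq x).hasFDerivAt
  have h2 := ((h.const_mul (-g)).exp).const_mul (-2 * g * c)
  have h3 : HasFDerivAt (fun x : Ed d => innerSL ℝ x) (innerSL ℝ) x :=
    (innerSL ℝ (E := Ed d)).hasFDerivAt
  have h4 := (h2.smul h3).fderiv
  simp only [hess, Matrix.of_apply, iteratedFDeriv_two_apply, h1]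
  erw [h4]
  have hij : (innerSL ℝ (EuclideanSpace.single i (1 : ℝ) : Ed d))
      (EuclideanSpace.single j (1 : ℝ)) = if i = j then 1 else 0 := by
    rw [innerSL_apply_apply, EuclideanSpace.inner_single_left]
    simp [Pi.single_apply]
  simp [EuclideanSpace.inner_single_right]
  erw [hij]
  split_ifs <;> ring

lemma gPsi_pucci {d : ℕ} (c g lam Lam : ℝ) (hc : 0 ≤ c) (hg : 0 ≤ g) (hLam : lam ≤ Lam)
    (x : Ed d) :
    c * Real.exp (-g * ‖x‖ ^ 2) * (4 * g ^ 2 * (lam * ‖x‖ ^ 2) - 2 * g * (Lam * d)) ≤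
      pucciMinus lam Lam (hess (gPsi (d := d) c g) x) := by
  unfold pucciMinus
  apply le_csInf
  · refine Set.Nonempty.image _ ⟨lam • (1 : Matrix (Fin d) (Fin d) ℝ), ?_, ?_, ?_⟩
    · simp [Matrix.IsSymm]
    · simpa using Matrix.PosSemidef.zero
    · rw [← sub_smul]
      exact Matrix.PosSemidef.one.smul (sub_nonneg.2 hLam)
  · rintro _ ⟨A, ⟨hs, hA1, hA2⟩, rfl⟩
    have htr : A.trace ≤ Lam * d := by
      have := hA2.trace_nonneg
      simp [Matrix.trace_sub, Matrix.trace_smul] at this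
      linarith
    have hq : lam * ‖x‖ ^ 2 ≤ ∑ i, ∑ j, A i j * (x j * x i) := by
      have := hA1.dotProduct_mulVec_nonneg (fun i => x i)
      simp only [Matrix.sub_mulVec, Matrix.smul_mulVec, Matrix.one_mulVec, dotProduct_sub,
        dotProduct_smul] at this
      have e1 : (star fun i => x i) ⬝ᵥ (fun i => x i) = ‖x‖ ^ 2 := by
        rw [EuclideanSpace.norm_sq_eq]; simp [dotProduct, ← pow_two]
      have e2 : (star fun i => x i) ⬝ᵥ (A.mulVec (fun i => x i)) = ∑ i, ∑ j, A i j * (x j * x i) := by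
        simp only [dotProduct, Matrix.mulVec, Finset.mul_sum]
        refine Finset.sum_congr rfl fun i _ => Finset.sum_congr rfl fun j _ => ?_
        simp
        ring
      rw [e1, e2] at this
      simp only [smul_eq_mul] at this
      linarith
    have hT : (A * hess (gPsi (d := d) c g) x).trace =
        c * Real.exp (-g * ‖x‖ ^ 2) *
          (4 * g ^ 2 * (∑ i, ∑ j, A i j * (x j * x i)) - 2 * g * A.trace) := by
      simp only [Matrix.trace, Matrix.diag, Matrix.mul_apply, gPsi_hess]
      rw [Finset.mul_sum, Finset.mul_sum, ← Finset.sum_sub_distrib, Finset.mul_sum]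
      refine Finset.sum_congr rfl fun i _ => ?_
      have : 2 * g * A i i = ∑ j, 2 * g * (A i j * (if j = i then 1 else 0)) := by
        rw [← Finset.mul_sum]; simp
      rw [this, Finset.mul_sum, ← Finset.sum_sub_distrib, Finset.mul_sum]
      refine Finset.sum_congr rfl fun j _ => ?_
      ring
    show _ ≤ (A * hess (gPsi (d := d) c g) x).trace
    rw [hT]
    have := Real.exp_pos (-g * ‖x‖ ^ 2)
    gcongr

lemma gPsi_delta {d : ℕ} (c g r : ℝ) (hc : 0 ≤ c) (hg : 0 ≤ g) (hr : 0 < r) (x z : Ed d) :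
    max (-deltaOp (gPsi (d := d) c g) r x z) 0 ≤
      c * Real.exp (-g * ‖x‖ ^ 2) * (g / r ^ 2 + 1) * min (‖r • z‖ ^ 2) 1 := by
  have hE := Real.exp_pos (-g * ‖x‖ ^ 2)
  have hn : ‖r • z‖ = r * ‖z‖ := by rw [norm_smul, Real.norm_of_nonneg hr.le]
  apply max_le _ (by positivity)
  unfold deltaOp
  by_cases hz : z ∈ Metric.ball (0 : Ed d) (1 / r)
  · rw [Set.indicator_of_mem hz, gPsi_gradient]
    rw [mem_ball_zero_iff, lt_div_iff₀ hr] at hz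
    have h0 := norm_nonneg z
    rw [hn, min_eq_left (by nlinarith [mul_nonneg hr.le h0])]
    have hx : ‖x + z‖ ^ 2 = ‖x‖ ^ 2 + 2 * ⟪x, z⟫ + ‖z‖ ^ 2 := norm_add_sq_real x z
    have he : Real.exp (-g * ‖x‖ ^ 2) * (1 - g * (2 * ⟪x, z⟫ + ‖z‖ ^ 2)) ≤
        Real.exp (-g * ‖x + z‖ ^ 2) := by
      rw [hx, show -g * (‖x‖ ^ 2 + 2 * ⟪x, z⟫ + ‖z‖ ^ 2) =
        -g * ‖x‖ ^ 2 + (-g * (2 * ⟪x, z⟫ + ‖z‖ ^ 2)) by ring, Real.exp_add]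
      gcongr
      have := Real.add_one_le_exp (-g * (2 * ⟪x, z⟫ + ‖z‖ ^ 2))
      linarith
    have he2 := mul_le_mul_of_nonneg_left he hc
    have e : c * Real.exp (-g * ‖x‖ ^ 2) * (g / r ^ 2 + 1) * (r * ‖z‖) ^ 2 =
       c * Real.exp (-g * ‖x‖ ^ 2) * (g * ‖z‖ ^ 2) +
       c * Real.exp (-g * ‖x‖ ^ 2) * (r * ‖z‖) ^ 2 := by
      field_simp
    rw [e]
    have : 0 ≤ c * Real.exp (-g * ‖x‖ ^ 2) * (r * ‖z‖) ^ 2 := by positivity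
    simp only [gPsi, inner_smul_left]
    simp
    simp only [neg_mul] at *
    linarith
  · rw [Set.indicator_of_notMem hz]
    rw [mem_ball_zero_iff, lt_div_iff₀ hr, not_lt] at hz
    rw [hn, min_eq_right (by nlinarith)]
    have h1 : 0 ≤ c * Real.exp (-g * ‖x + z‖ ^ 2) := by positivity
    have h2 : 0 ≤ c * Real.exp (-g * ‖x‖ ^ 2) * (g / r ^ 2) := by positivity
    simp only [gPsi]
    linarith

lemma gPsi_nl {d : ℕ} (c g r : ℝ) (hc : 0 ≤ c) (hg : 0 ≤ g) (hr : 0 < r)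
    (K : Ed d → ℝ) (hK : KernCond K) (x : Ed d) :
    -(c * Real.exp (-g * ‖x‖ ^ 2) * (g + r ^ 2) * ∫ z, min (‖z‖ ^ 2) 1 * K z) ≤
      nlMinus K r (gPsi (d := d) c g) x := by
  obtain ⟨-, hK0, hKi⟩ := hK
  unfold nlMinus
  apply neg_le_neg
  set G : Ed d → ℝ := fun z => min (‖z‖ ^ 2) 1 * K z with hG
  have hint : Integrable (fun z => G (r • z)) := hKi.comp_smul hr.ne'
  have hcv : ∫ z, G (r • z) = (r ^ d)⁻¹ * ∫ z, G z := by
    rw [Measure.integral_comp_smul]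
    simp [abs_of_pos hr]
  have hE := Real.exp_pos (-g * ‖x‖ ^ 2)
  calc ∫ z, max (-deltaOp (gPsi (d := d) c g) r x z) 0 * Kresc K r z
      ≤ ∫ z, (c * Real.exp (-g * ‖x‖ ^ 2) * (g + r ^ 2) * r ^ d) * G (r • z) := by
        apply integral_mono_of_nonneg
        · refine Filter.Eventually.of_forall fun z => ?_
          have := hK0 (r • z)
          simp only [Kresc, Pi.zero_apply]
          positivity
        · exact hint.const_mul _
        · refine Filter.Eventually.of_forall fun z => ?_
          have := hK0 (r • z)
          have h1 : 0 ≤ Kresc K r z := by unfold Kresc; positivity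
          have h2 := mul_le_mul_of_nonneg_right (gPsi_delta c g r hc hg hr x z) h1
          refine h2.trans (le_of_eq ?_)
          simp only [hG, Kresc]
          rw [pow_add]
          field_simp
    _ = _ := by
        rw [integral_const_mul, hcv]
        field_simp

set_option maxHeartbeats 2000000

/-- the rescaled special function (Corollary 3.2). -/
theorem special_function_rescaled {d : ℕ} (hd : 1 ≤ d) (lam Lam C0 : ℝ)
    (hlam : 0 < lam) (hLam : lam ≤ Lam) (hC0 : 0 ≤ C0)
    (K : Ed d → ℝ) (hK : KernCond K) :
    ∃ (Ψ : Ed d → ℝ) (C : ℝ) (ξ : Ed d → ℝ),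
      ContDiff ℝ 3 Ψ ∧ IsBddFun Ψ ∧ 0 < C ∧
      Continuous ξ ∧ (∀ x, ξ x ∈ Icc (0 : ℝ) 1) ∧
      Function.support ξ ⊆ cube d (1 / (9 * Real.sqrt d)) ∧
      (∀ x ∉ Metric.ball (0 : Ed d) 1, Ψ x ≤ 0) ∧
      (∀ x ∈ cube d (3 * (1 / (9 * Real.sqrt d))), 2 ≤ Ψ x) ∧
      ∀ r : ℝ, 0 < r → r ≤ 9 * Real.sqrt d → ∀ x : Ed d,
        -C * ξ x ≤ pucciMinus lam Lam (hess Ψ x) + nlMinus K r Ψ x - C0 * ‖gradient Ψ x‖ := by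
  have hd' : (0 : ℝ) < d := by exact_mod_cast hd
  have hsq : 0 < Real.sqrt d := Real.sqrt_pos.2 hd'
  have hsq2 : Real.sqrt d ^ 2 = d := Real.sq_sqrt hd'.le
  set r0 : ℝ := 1 / (9 * Real.sqrt d) with hr0
  have hr0p : 0 < r0 := by positivity
  have hr0d : (d : ℝ) * (3 * r0) ^ 2 = 1 / 9 := by
    rw [hr0]; field_simp; rw [hsq2]; ring
  set s : ℝ := r0 / 2 with hs
  have hsp : 0 < s := by positivity
  set M : ℝ := ∫ z, min (‖z‖ ^ 2) 1 * K z with hM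
  have hM0 : 0 ≤ M := by
    refine integral_nonneg fun z => ?_
    have := hK.2.1 z
    positivity
  have hLamp : 0 < Lam := hlam.trans_le hLam
  set B : ℝ := 2 * (Lam * d) + M + 81 * d * M with hB
  have hB0 : 0 < B := by positivity
  set g : ℝ := 1 + C0 / (lam * s) + B / (lam * s ^ 2) with hg
  have hg1 : 1 ≤ g := by
    have : 0 ≤ C0 / (lam * s) + B / (lam * s ^ 2) := by positivity
    linarith
  have hg0 : 0 < g := by linarith
  have hgl : C0 / s + B / s ^ 2 ≤ g * lam := by
    have : g * lam = lam + C0 / s + B / s ^ 2 := by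
      rw [hg]; field_simp
    linarith
  have hden : 0 < Real.exp (-g * (1 / 9)) - Real.exp (-g) := by
    rw [sub_pos]; apply Real.exp_lt_exp.2; linarith
  set c : ℝ := 2 / (Real.exp (-g * (1 / 9)) - Real.exp (-g)) with hc
  have hcp : 0 < c := by positivity
  set C : ℝ := c * (g * (2 * C0 * s + B)) with hC
  have hCp : 0 < C := by positivity
  clear_value C c g B M s r0
  refine ⟨gPsi c g, C, fun x => max 0 (min 1 (2 - ‖x‖ / s)), gPsi_contDiff c g 3, ?_, hCp, ?_, ?_,
    ?_, ?_, ?_, ?_⟩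
  · refine ⟨c, fun x => ?_⟩
    have h1 : Real.exp (-g * ‖x‖ ^ 2) ≤ 1 := Real.exp_le_one_iff.2 (by rw [neg_mul, neg_nonpos]; positivity)
    have h2 : Real.exp (-g) ≤ 1 := Real.exp_le_one_iff.2 (by linarith)
    have h3 := Real.exp_pos (-g * ‖x‖ ^ 2)
    have h4 := Real.exp_pos (-g)
    rw [gPsi, abs_mul, abs_of_pos hcp]
    apply mul_le_of_le_one_right hcp.le
    rw [abs_le]; constructor <;> linarith
  · fun_prop
  · intro x
    exact ⟨le_max_left _ _, max_le zero_le_one (min_le_left _ _)⟩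
  · intro x hx i
    have h1 : ‖x‖ / s < 2 := by
      by_contra! h
      apply hx
      show max 0 (min 1 (2 - ‖x‖ / s)) = 0
      exact max_eq_left ((min_le_right _ _).trans (by linarith))
    rw [div_lt_iff₀ hsp] at h1
    have h2 : |x i| ≤ ‖x‖ := PiLp.norm_apply_le x i
    simp
    linarith
  · intro x hx
    rw [mem_ball_zero_iff, not_lt] at hx
    have : Real.exp (-g * ‖x‖ ^ 2) ≤ Real.exp (-g) := Real.exp_le_exp.2 (by nlinarith [one_le_pow₀ hx (n := 2)])
    exact mul_nonpos_of_nonneg_of_nonpos hcp.le (by linarith)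
  · intro x hx
    have h1 : ‖x‖ ^ 2 ≤ 1 / 9 := by
      rw [EuclideanSpace.norm_sq_eq, ← hr0d]
      calc ∑ i, ‖x i‖ ^ 2 ≤ ∑ i : Fin d, (3 * r0) ^ 2 := by
            refine Finset.sum_le_sum fun i _ => ?_
            have := hx i
            simp only [PiLp.zero_apply, sub_zero] at this
            rw [Real.norm_eq_abs]
            gcongr
        _ = _ := by simp
    have h2 : Real.exp (-g * (1 / 9)) ≤ Real.exp (-g * ‖x‖ ^ 2) :=
      Real.exp_le_exp.2 (by nlinarith)
    calc 2 = c * (Real.exp (-g * (1 / 9)) - Real.exp (-g)) := by rw [hc, div_mul_cancel₀ _ hden.ne']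
      _ ≤ _ := by unfold gPsi; gcongr
  · intro r hr hr2 x
    have hP := gPsi_pucci c g lam Lam hcp.le hg0.le hLam x
    have hN := gPsi_nl c g r hcp.le hg0.le hr K hK x
    rw [← hM] at hN
    have hE := Real.exp_pos (-g * ‖x‖ ^ 2)
    have hE1 : Real.exp (-g * ‖x‖ ^ 2) ≤ 1 :=
      Real.exp_le_one_iff.2 (by rw [neg_mul, neg_nonpos]; positivity)
    set E := Real.exp (-g * ‖x‖ ^ 2) with hEdef
    clear_value E
    have hG : ‖gradient (gPsi (d := d) c g) x‖ = 2 * g * c * E * ‖x‖ := by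
      rw [gPsi_gradient, norm_smul, ← hEdef]
      congr 1
      rw [Real.norm_eq_abs, show -2 * g * c * E = -(2 * g * c * E) by ring, abs_neg,
        abs_of_pos (by positivity)]
    rw [hG]
    have hr3 : r ^ 2 ≤ 81 * d := by
      have : r ^ 2 ≤ (9 * Real.sqrt d) ^ 2 := by gcongr
      rw [mul_pow, hsq2] at this
      linarith
    have hrM : (g + r ^ 2) * M ≤ g * (M + 81 * d * M) := by
      have h1 : r ^ 2 * M ≤ 81 * d * M := mul_le_mul_of_nonneg_right hr3 hM0
      have h2 : 1 * (81 * d * M) ≤ g * (81 * d * M) :=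
        mul_le_mul_of_nonneg_right hg1 (by positivity)
      linarith
    have hN2 : -(c * E * (g * (M + 81 * d * M))) ≤ nlMinus K r (gPsi (d := d) c g) x := by
      refine le_trans ?_ hN
      rw [mul_assoc (c * E)]
      gcongr
    have hkey : c * E * g * (4 * (g * lam) * ‖x‖ ^ 2 - 2 * C0 * ‖x‖ - B) ≤
        pucciMinus lam Lam (hess (gPsi (d := d) c g) x) + nlMinus K r (gPsi (d := d) c g) x
          - C0 * (2 * g * c * E * ‖x‖) := by
      rw [hB]; linarith
    refine le_trans ?_ hkey
    have hx0 := norm_nonneg x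
    rcases le_total ‖x‖ s with hxs | hxs
    · have hxi : max 0 (min 1 (2 - ‖x‖ / s)) = 1 := by
        have : ‖x‖ / s ≤ 1 := (div_le_one hsp).2 hxs
        rw [min_eq_left (by linarith), max_eq_right zero_le_one]
      simp only [hxi]
      have h1 : 0 ≤ c * E * g * (4 * (g * lam) * ‖x‖ ^ 2) := by positivity
      have h2 : c * E * g * (2 * C0 * ‖x‖ + B) ≤ c * 1 * g * (2 * C0 * s + B) := by gcongr
      rw [hC]; linarith
    · have h0 : 0 ≤ max 0 (min 1 (2 - ‖x‖ / s)) := le_max_left _ _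
      have h1 : (C0 / s + B / s ^ 2) * ‖x‖ ^ 2 ≤ g * lam * ‖x‖ ^ 2 := by gcongr
      have h2 : C0 * ‖x‖ ≤ C0 / s * ‖x‖ ^ 2 := by
        rw [div_mul_eq_mul_div, le_div_iff₀ hsp]
        nlinarith [mul_nonneg (mul_nonneg hC0 hx0) (sub_nonneg.2 hxs)]
      have h3 : B ≤ B / s ^ 2 * ‖x‖ ^ 2 := by
        rw [div_mul_eq_mul_div, le_div_iff₀ (by positivity)]
        gcongr
      have h5 : 0 ≤ C0 * ‖x‖ := by positivity
      have h4 : 0 ≤ c * E * g * (4 * (g * lam) * ‖x‖ ^ 2 - 2 * C0 * ‖x‖ - B) := by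
        apply mul_nonneg (by positivity)
        linarith
      refine le_trans ?_ h4
      have := mul_nonneg hCp.le h0
      linarith
end
end

section
/- Let r₀ := 1/(9√d). There exist positive constants ε₀, α and M depending only on λ, Λ, K, C₀ and d, such that: for any 0 < r ≤ 9√d, any f ∈ L^d(B₁) ∩ C(B₁) with ‖f‖_{L^d(B₁)} ≤ ε₀, and any nonnegative bounded lower semicontinuous function u that is a viscosity supersolution of −P⁻(D²u) − P⁻_{K,r}(u) + C₀ r |Du| ≥ f in B₁ with inf_{Q_{3r₀}} u ≤ 1, one has the Lebesgue-measure estimate |Q_{r₀} ∩ G^u_M| ≥ α|Q_{r₀}|. -/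
open MeasureTheory Metric Set
open scoped RealInnerProductSpace ENNReal

noncomputable section

lemma kern_bound {d : ℕ} (K : Ed d → ℝ) (hK : KernCond K) :
    ∃ κ : ℝ, 0 ≤ κ ∧ ∀ r : ℝ, 0 < r → r ≤ 9 * Real.sqrt d → ∀ (φ : Ed d → ℝ) (x : Ed d) (A : ℝ),
      0 ≤ A → (∀ z, ‖z‖ < 1 / r → -(A * ‖z‖ ^ 2) ≤ deltaOp φ r x z) →
      (∀ z, 1 / r ≤ ‖z‖ → -A ≤ deltaOp φ r x z) → -nlMinus K r φ x ≤ A * κ := by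
  obtain ⟨_, hK0, hKi⟩ := hK
  set G : Ed d → ℝ := fun z => min (‖z‖ ^ 2) 1 * K z with hG
  have hG0 : ∀ z, 0 ≤ G z := fun z => mul_nonneg (by positivity) (hK0 z)
  refine ⟨(1 + 81 * d) * ∫ z, G z, mul_nonneg (by positivity) (integral_nonneg hG0), ?_⟩
  intro r hr hr9 φ x A hA h1 h2
  have hr2 : r ^ 2 ≤ 81 * (d : ℝ) := by
    calc r ^ 2 ≤ (9 * Real.sqrt d) ^ 2 := by gcongr
      _ = 81 * (d : ℝ) := by rw [mul_pow, Real.sq_sqrt (by positivity)]; norm_num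
  have hGint : Integrable (fun z => G (r • z)) := hKi.comp_smul hr.ne'
  have hval : ∫ z, G (r • z) = (r ^ d)⁻¹ * ∫ z, G z := by
    rw [Measure.integral_comp_smul]
    simp [abs_of_pos hr]
  have key : ∫ z, max (-deltaOp φ r x z) 0 * Kresc K r z ≤
      ∫ z, A * (1 + 81 * d) * r ^ d * G (r • z) := by
    apply integral_mono_of_nonneg
    · exact Filter.Eventually.of_forall fun z => mul_nonneg (le_max_right _ _)
        (mul_nonneg (by positivity) (hK0 _))
    · exact hGint.const_mul _
    · refine Filter.Eventually.of_forall fun z => ?_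
      have hKz := hK0 (r • z)
      simp only [Kresc, hG, norm_smul, Real.norm_eq_abs, abs_of_pos hr]
      by_cases hz : ‖z‖ < 1 / r
      · have hrz : r * ‖z‖ < 1 := by
          rw [lt_div_iff₀ hr] at hz; linarith
        have : min ((r * ‖z‖) ^ 2) 1 = (r * ‖z‖) ^ 2 := by
          apply min_eq_left; nlinarith [norm_nonneg z, mul_nonneg hr.le (norm_nonneg z)]
        rw [this]
        have hm : max (-deltaOp φ r x z) 0 ≤ A * ‖z‖ ^ 2 :=
          max_le (by linarith [h1 z hz]) (by positivity)
        calc _ ≤ A * ‖z‖ ^ 2 * (r ^ (d + 2) * K (r • z)) := by gcongr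
          _ = A * 1 * r ^ d * ((r * ‖z‖) ^ 2 * K (r • z)) := by ring
          _ ≤ _ := by gcongr; linarith [show (0:ℝ) ≤ 81 * d by positivity]
      · push Not at hz
        have hrz : 1 ≤ r * ‖z‖ := by
          rw [div_le_iff₀ hr] at hz; linarith
        have : min ((r * ‖z‖) ^ 2) 1 = 1 := by
          apply min_eq_right; nlinarith
        rw [this]
        have hm : max (-deltaOp φ r x z) 0 ≤ A :=
          max_le (by linarith [h2 z hz]) (by positivity)
        calc _ ≤ A * (r ^ (d + 2) * K (r • z)) := by gcongr
          _ = A * (r ^ 2) * r ^ d * (1 * K (r • z)) := by ring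
          _ ≤ _ := by gcongr; linarith
  rw [integral_const_mul, hval] at key
  simp only [nlMinus, neg_neg]
  refine key.trans (le_of_eq ?_)
  have : r ^ d ≠ 0 := by positivity
  field_simp

lemma elliptic_trace {d : ℕ} {lam Lam : ℝ} {A : Matrix (Fin d) (Fin d) ℝ}
    (hA : A ∈ ellipticSet lam Lam d) : A.trace ≤ Lam * d := by
  have h := hA.2.2.trace_nonneg
  simp [Matrix.trace_sub, Matrix.trace_smul, Matrix.trace_one] at h
  linarith

lemma elliptic_quad {d : ℕ} {lam Lam : ℝ} {A : Matrix (Fin d) (Fin d) ℝ}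
    (hA : A ∈ ellipticSet lam Lam d) (w : Ed d) :
    lam * ‖w‖ ^ 2 ≤ (A * Matrix.of (fun i j => w i * w j)).trace := by
  have h := hA.2.1.dotProduct_mulVec_nonneg (fun i => w i)
  have e1 : (A * Matrix.of (fun i j => w i * w j)).trace =
      (fun i => w i) ⬝ᵥ (A.mulVec (fun i => w i)) := by
    simp only [Matrix.trace, Matrix.diag, Matrix.mul_apply, Matrix.of_apply, dotProduct,
      Matrix.mulVec, Finset.mul_sum]
    refine Finset.sum_congr rfl fun i _ => Finset.sum_congr rfl fun j _ => by ring
  have e2 : (fun i => w i) ⬝ᵥ (fun i => w i) = ‖w‖ ^ 2 := by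
    rw [EuclideanSpace.norm_sq_eq]
    simp [dotProduct, sq]
  rw [Matrix.sub_mulVec, dotProduct_sub, Matrix.smul_mulVec, Matrix.one_mulVec] at h
  simp only [star_trivial, dotProduct_smul, smul_eq_mul] at h
  rw [e1, ← e2]
  linarith

lemma pucci_bound {d : ℕ} {lam Lam : ℝ} (hLam : lam ≤ Lam)
    (X : Matrix (Fin d) (Fin d) ℝ) (w1 w2 : Ed d) (a1 b1 a2 b2 : ℝ)
    (ha1 : 0 ≤ a1) (hb1 : 0 ≤ b1) (ha2 : 0 ≤ a2) (hb2 : 0 ≤ b2)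
    (hX : X = a1 • Matrix.of (fun i j => w1 i * w1 j) - b1 • (1 : Matrix (Fin d) (Fin d) ℝ) +
      (a2 • Matrix.of (fun i j => w2 i * w2 j) - b2 • (1 : Matrix (Fin d) (Fin d) ℝ))) :
    a1 * (lam * ‖w1‖ ^ 2) - b1 * (Lam * d) + (a2 * (lam * ‖w2‖ ^ 2) - b2 * (Lam * d)) ≤
      pucciMinus lam Lam X := by
  apply le_csInf
  · refine ⟨_, lam • (1 : Matrix (Fin d) (Fin d) ℝ), ⟨?_, ?_, ?_⟩, rfl⟩
    · simp [Matrix.IsSymm]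
    · rw [sub_self]; exact Matrix.PosSemidef.zero
    · rw [← sub_smul]; exact Matrix.PosSemidef.one.smul (by linarith)
  · rintro _ ⟨A, hA, rfl⟩
    have h1 := elliptic_quad hA w1
    have h2 := elliptic_quad hA w2
    have h3 := elliptic_trace hA
    simp only [hX, mul_add, mul_sub, Matrix.mul_smul, Matrix.trace_add, Matrix.trace_sub,
      Matrix.trace_smul, mul_one, smul_eq_mul]
    gcongr

/-- Gaussian bump. -/
def gs {d : ℕ} (γ : ℝ) (y0 y : Ed d) : ℝ := Real.exp (-(γ * ‖y - y0‖ ^ 2))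

lemma gs_pos {d : ℕ} (γ : ℝ) (y0 y : Ed d) : 0 < gs γ y0 y := Real.exp_pos _

lemma gs_le_one {d : ℕ} {γ : ℝ} (hγ : 0 ≤ γ) (y0 y : Ed d) : gs γ y0 y ≤ 1 := by
  apply Real.exp_le_one_iff.2
  have : 0 ≤ γ * ‖y - y0‖ ^ 2 := by positivity
  linarith

lemma gs_contDiff {d : ℕ} (γ : ℝ) (y0 : Ed d) : ContDiff ℝ 2 (gs γ y0) := by
  unfold gs
  exact ((contDiff_const.mul ((contDiff_id.sub contDiff_const).norm_sq ℝ)).neg).exp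

lemma gs_hasFDerivAt {d : ℕ} (γ : ℝ) (y0 y : Ed d) :
    HasFDerivAt (gs γ y0) ((-(2 * γ * gs γ y0 y)) • innerSL ℝ (y - y0)) y := by
  have h1 : HasFDerivAt (fun y : Ed d => y - y0) (ContinuousLinearMap.id ℝ (Ed d)) y :=
    (hasFDerivAt_id y).sub_const y0
  have h2 := ((h1.norm_sq.const_mul γ).neg).exp
  refine h2.congr_fderiv ?_
  ext v
  simp [gs]
  ring

lemma gs_lower {d : ℕ} (γ : ℝ) (y0 x z : Ed d) :
    -(γ * gs γ y0 x * ‖z‖ ^ 2) ≤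
      gs γ y0 (x + z) - gs γ y0 x + 2 * γ * gs γ y0 x * ⟪x - y0, z⟫ := by
  have e : gs γ y0 (x + z) = gs γ y0 x * Real.exp (-(γ * (2 * ⟪x - y0, z⟫ + ‖z‖ ^ 2))) := by
    unfold gs
    rw [← Real.exp_add, show x + z - y0 = (x - y0) + z by abel, norm_add_sq_real]
    congr 1; ring
  have h := Real.add_one_le_exp (-(γ * (2 * ⟪x - y0, z⟫ + ‖z‖ ^ 2)))
  have h2 := mul_le_mul_of_nonneg_left h (gs_pos γ y0 x).le
  rw [e]
  linarith

/-- cutoff -/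
def chi (d : ℕ) : ContDiffBump (0 : Ed d) := ⟨1, 2, one_pos, one_lt_two⟩

/-- cut-off linear function -/
def ell {d : ℕ} (p y : Ed d) : ℝ := chi d y * ⟪p, y⟫

lemma ell_eq {d : ℕ} (p : Ed d) {y : Ed d} (hy : ‖y‖ ≤ 1) : ell p y = ⟪p, y⟫ := by
  have : chi d y = 1 := (chi d).one_of_mem_closedBall (by simpa [chi] using hy)
  simp [ell, this]

lemma ell_bound {d : ℕ} (p y : Ed d) : |ell p y| ≤ 2 * ‖p‖ := by
  by_cases hy : 2 ≤ ‖y‖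
  · have : chi d y = 0 := (chi d).zero_of_le_dist (by simpa [chi] using hy)
    simp [ell, this]
  · push Not at hy
    rw [ell, abs_mul, abs_of_nonneg (chi d).nonneg]
    calc _ ≤ 1 * (‖p‖ * ‖y‖) :=
          mul_le_mul (chi d).le_one (abs_real_inner_le_norm _ _) (abs_nonneg _) zero_le_one
      _ ≤ _ := by nlinarith [norm_nonneg p]

lemma ell_contDiff {d : ℕ} (p : Ed d) : ContDiff ℝ 2 (ell p) := by
  unfold ell
  exact (chi d).contDiff.mul (contDiff_const.inner ℝ contDiff_id)

lemma ell_cont {d : ℕ} : Continuous (fun q : Ed d × Ed d => ell q.1 q.2) := by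
  unfold ell
  exact ((chi d).continuous.comp continuous_snd).mul (continuous_fst.inner continuous_snd)

/-- test function -/
def tf {d : ℕ} (m γ : ℝ) (p : Ed d) (h γ' : ℝ) (y0 : Ed d) (c : ℝ) (y : Ed d) : ℝ :=
  m * gs γ 0 y + ell p y + h * gs γ' y0 y + c

/-- gradient field of the test function -/
def tfV {d : ℕ} (m γ : ℝ) (p : Ed d) (h γ' : ℝ) (y0 : Ed d) (y : Ed d) : Ed d :=
  (m * (-(2 * γ)) * gs γ 0 y) • (y - 0) + p + (h * (-(2 * γ')) * gs γ' y0 y) • (y - y0)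

lemma tf_contDiff {d : ℕ} (m γ : ℝ) (p : Ed d) (h γ' : ℝ) (y0 : Ed d) (c : ℝ) :
    ContDiff ℝ 2 (tf m γ p h γ' y0 c) := by
  unfold tf
  exact (((contDiff_const.mul (gs_contDiff γ 0)).add (ell_contDiff p)).add
    (contDiff_const.mul (gs_contDiff γ' y0))).add contDiff_const

lemma tf_bdd {d : ℕ} (m γ : ℝ) (p : Ed d) (h γ' : ℝ) (y0 : Ed d) (c : ℝ)
    (hγ : 0 ≤ γ) (hγ' : 0 ≤ γ') : IsBddFun (tf m γ p h γ' y0 c) := by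
  refine ⟨|m| + 2 * ‖p‖ + |h| + |c|, fun y => ?_⟩
  unfold tf
  have a1 : |m * gs γ 0 y| ≤ |m| := by
    rw [abs_mul, abs_of_pos (gs_pos _ _ _)]
    exact mul_le_of_le_one_right (abs_nonneg _) (gs_le_one hγ _ _)
  have a2 : |h * gs γ' y0 y| ≤ |h| := by
    rw [abs_mul, abs_of_pos (gs_pos _ _ _)]
    exact mul_le_of_le_one_right (abs_nonneg _) (gs_le_one hγ' _ _)
  have a3 := ell_bound p y
  calc _ ≤ |m * gs γ 0 y + ell p y + h * gs γ' y0 y| + |c| := abs_add_le _ _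
    _ ≤ |m * gs γ 0 y + ell p y| + |h * gs γ' y0 y| + |c| := by gcongr; exact abs_add_le _ _
    _ ≤ |m * gs γ 0 y| + |ell p y| + |h * gs γ' y0 y| + |c| := by gcongr; exact abs_add_le _ _
    _ ≤ _ := by gcongr

lemma tf_hasFDerivAt {d : ℕ} (m γ : ℝ) (p : Ed d) (h γ' : ℝ) (y0 : Ed d) (c : ℝ) (x : Ed d)
    (hx : ‖x‖ < 1) :
    HasFDerivAt (tf m γ p h γ' y0 c) (innerSL ℝ (tfV m γ p h γ' y0 x)) x := by
  have hl : HasFDerivAt (ell p) (innerSL ℝ p) x := by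
    have h0 : HasFDerivAt (fun y : Ed d => ⟪p, y⟫) (innerSL ℝ p) x := (innerSL ℝ p).hasFDerivAt
    refine h0.congr_of_eventuallyEq ?_
    have : Metric.ball (0 : Ed d) 1 ∈ nhds x := Metric.isOpen_ball.mem_nhds (by simpa using hx)
    filter_upwards [this] with y hy
    exact ell_eq p (by simpa using (mem_ball_zero_iff.1 hy).le)
  have := ((((gs_hasFDerivAt γ 0 x).const_mul m).add hl).add
    ((gs_hasFDerivAt γ' y0 x).const_mul h)).add_const c
  refine this.congr_fderiv ?_
  ext v
  simp only [tfV, add_apply, smul_apply, innerSL_apply_apply,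
    inner_add_left, real_inner_smul_left, smul_eq_mul]
  ring

lemma tf_gradient {d : ℕ} (m γ : ℝ) (p : Ed d) (h γ' : ℝ) (y0 : Ed d) (c : ℝ) (x : Ed d)
    (hx : ‖x‖ < 1) :
    gradient (tf m γ p h γ' y0 c) x = tfV m γ p h γ' y0 x := by
  apply HasGradientAt.gradient
  rw [hasGradientAt_iff_hasFDerivAt]
  exact tf_hasFDerivAt m γ p h γ' y0 c x hx

lemma tfV_hasFDerivAt {d : ℕ} (m γ : ℝ) (p : Ed d) (h γ' : ℝ) (y0 : Ed d) (x : Ed d) :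
    ∃ T : Ed d →L[ℝ] Ed d, HasFDerivAt (tfV m γ p h γ' y0) T x ∧ ∀ v w, ⟪T v, w⟫ =
      m * (-(2 * γ)) * gs γ 0 x * (⟪v, w⟫ - 2 * γ * ⟪x - 0, v⟫ * ⟪x - 0, w⟫) +
      h * (-(2 * γ')) * gs γ' y0 x * (⟪v, w⟫ - 2 * γ' * ⟪x - y0, v⟫ * ⟪x - y0, w⟫) := by
  have key : ∀ (a g : ℝ) (z : Ed d), HasFDerivAt (fun y => (a * gs g z y) • (y - z))
      ((a * gs g z x) • ContinuousLinearMap.id ℝ (Ed d) +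
        (a • ((-(2 * g * gs g z x)) • innerSL ℝ (x - z))).smulRight (x - z)) x := by
    intro a g z
    exact ((gs_hasFDerivAt g z x).const_mul a).smul ((hasFDerivAt_id x).sub_const z)
  refine ⟨_, ((key (m * (-(2 * γ))) γ 0).add_const p).add (key (h * (-(2 * γ'))) γ' y0), ?_⟩
  intro v w
  simp only [add_apply, smul_apply, innerSL_apply_apply,
    inner_add_left, real_inner_smul_left, smul_eq_mul, ContinuousLinearMap.smulRight_apply,
    ContinuousLinearMap.id_apply]
  ring

lemma tf_hess {d : ℕ} (m γ : ℝ) (p : Ed d) (h γ' : ℝ) (y0 : Ed d) (c : ℝ) (x : Ed d)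
    (hx : ‖x‖ < 1) :
    hess (tf m γ p h γ' y0 c) x =
      (4 * γ ^ 2 * (m * gs γ 0 x)) • Matrix.of (fun i j => (x - 0) i * (x - 0) j) -
        (2 * γ * (m * gs γ 0 x)) • (1 : Matrix (Fin d) (Fin d) ℝ) +
      ((4 * γ' ^ 2 * (h * gs γ' y0 x)) • Matrix.of (fun i j => (x - y0) i * (x - y0) j) -
        (2 * γ' * (h * gs γ' y0 x)) • (1 : Matrix (Fin d) (Fin d) ℝ)) := by
  obtain ⟨T, hT, hTi⟩ := tfV_hasFDerivAt m γ p h γ' y0 x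
  have h1 : HasFDerivAt (fderiv ℝ (tf m γ p h γ' y0 c))
      ((innerSL ℝ : Ed d →L[ℝ] Ed d →L[ℝ] ℝ).comp T) x := by
    have h0 : HasFDerivAt (fun y => innerSL ℝ (tfV m γ p h γ' y0 y))
        ((innerSL ℝ : Ed d →L[ℝ] Ed d →L[ℝ] ℝ).comp T) x :=
      (innerSL ℝ : Ed d →L[ℝ] Ed d →L[ℝ] ℝ).hasFDerivAt.comp x hT
    refine h0.congr_of_eventuallyEq ?_
    have : Metric.ball (0 : Ed d) 1 ∈ nhds x := Metric.isOpen_ball.mem_nhds (by simpa using hx)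
    filter_upwards [this] with y hy
    exact (tf_hasFDerivAt m γ p h γ' y0 c y (by simpa using (mem_ball_zero_iff.1 hy))).fderiv
  ext i j
  have e : hess (tf m γ p h γ' y0 c) x i j =
      ⟪T (EuclideanSpace.single i (1 : ℝ)), EuclideanSpace.single j (1 : ℝ)⟫ := by
    simp only [hess, Matrix.of_apply, iteratedFDeriv_two_apply, h1.fderiv]
    simp
  rw [e, hTi]
  simp only [Matrix.add_apply, Matrix.sub_apply, Matrix.smul_apply, Matrix.of_apply, smul_eq_mul,
    Matrix.one_apply, EuclideanSpace.inner_single_right, PiLp.single_apply]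
  simp only [one_mul, conj_trivial]
  by_cases hij : i = j
  · subst hij; simp; ring
  · simp [hij, Ne.symm hij]; ring

lemma ell_delta {d : ℕ} (p x z : Ed d) (hx : ‖x‖ < 3 / 4) :
    -(68 * ‖p‖ * ‖z‖ ^ 2) ≤ ell p (x + z) - ell p x - ⟪p, z⟫ := by
  have hp := norm_nonneg p
  by_cases hz : ‖z‖ < 1 / 4
  · have h1 : ‖x + z‖ ≤ 1 := (norm_add_le _ _).trans (by linarith)
    rw [ell_eq p h1, ell_eq p (by linarith), inner_add_right]
    have : 0 ≤ 68 * ‖p‖ * ‖z‖ ^ 2 := by positivity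
    linarith
  · push Not at hz
    have h1 := (abs_le.1 (ell_bound p (x + z))).1
    have h2 := (abs_le.1 (ell_bound p x)).2
    have h3 := real_inner_le_norm p z
    have h4 : ‖p‖ * (4 + ‖z‖) ≤ ‖p‖ * (68 * ‖z‖ ^ 2) := by
      gcongr; nlinarith
    linarith

lemma touch_ineq {d : ℕ} (lam Lam C0 : ℝ) (hlam : 0 < lam) (hLam : lam ≤ Lam) (hC0 : 0 ≤ C0)
    (K : Ed d → ℝ) (hK : KernCond K) :
    ∃ C1 Cl : ℝ, 0 ≤ C1 ∧ 0 ≤ Cl ∧ ∀ r : ℝ, 0 < r → r ≤ 9 * Real.sqrt d →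
      ∀ (f u : Ed d → ℝ), SupersolExtremal lam Lam C0 r K f (Metric.ball (0 : Ed d) 1) u →
      ∀ (m γ : ℝ) (p : Ed d) (h γ' : ℝ) (y0 : Ed d) (c : ℝ) (x : Ed d),
        0 ≤ m → 0 ≤ h → 1 ≤ γ → 1 ≤ γ' → ‖x‖ < 3 / 4 → ‖x - y0‖ ≤ 2 →
        (∀ y, tf m γ p h γ' y0 c y ≤ u y) → u x = tf m γ p h γ' y0 c x →
        f x ≤ -(m * gs γ 0 x * γ * (4 * lam * γ * ‖x‖ ^ 2 - C1)) -
          h * gs γ' y0 x * γ' * (4 * lam * γ' * ‖x - y0‖ ^ 2 - C1) + Cl * ‖p‖ := by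
  obtain ⟨κ, hκ, hkern⟩ := kern_bound K hK
  refine ⟨2 * Lam * d + κ + 36 * Real.sqrt d * C0, 68 * κ + 9 * Real.sqrt d * C0, ?_, ?_, ?_⟩
  · have : 0 ≤ Lam := by linarith
    positivity
  · positivity
  intro r hr hr9 f u hu m γ p h γ' y0 c x hm hh hγ hγ' hx hxy hle heq
  have hx1 : ‖x‖ < 1 := by linarith
  have H := hu _ (tf_contDiff m γ p h γ' y0 c) (tf_bdd m γ p h γ' y0 c (by linarith) (by linarith))
    x (by simpa using hx1) hle heq
  have hg := gs_pos γ 0 x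
  have hg' := gs_pos γ' y0 x
  have hG : 0 ≤ m * gs γ 0 x := by positivity
  have hG' : 0 ≤ h * gs γ' y0 x := by positivity
  -- Pucci term
  have hP := pucci_bound hLam _ (x - 0) (x - y0) _ _ _ _ (by positivity) (by positivity)
    (by positivity) (by positivity) (tf_hess m γ p h γ' y0 c x hx1)
  -- nonlocal term
  have hgrad := tf_gradient m γ p h γ' y0 c x hx1
  have hN : -nlMinus K r (tf m γ p h γ' y0 c) x ≤
      (γ * (m * gs γ 0 x) + 68 * ‖p‖ + γ' * (h * gs γ' y0 x)) * κ := by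
    apply hkern r hr hr9 _ _ _ (by positivity)
    · intro z hz
      have hzb : z ∈ Metric.ball (0 : Ed d) (1 / r) := by simpa using hz
      rw [deltaOp, indicator_of_mem hzb, hgrad]
      have a1 := mul_le_mul_of_nonneg_left (gs_lower γ 0 x z) hm
      have a2 := mul_le_mul_of_nonneg_left (gs_lower γ' y0 x z) hh
      have a3 := ell_delta p x z hx
      simp only [tf, tfV, inner_add_left, real_inner_smul_left]
      linarith
    · intro z hz
      have hzb : z ∉ Metric.ball (0 : Ed d) (1 / r) := by simpa using hz
      rw [deltaOp, indicator_of_notMem hzb]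
      have a1 : 0 ≤ m * gs γ 0 (x + z) := mul_nonneg hm (gs_pos _ _ _).le
      have a2 : 0 ≤ h * gs γ' y0 (x + z) := mul_nonneg hh (gs_pos _ _ _).le
      have h1 := (abs_le.1 (ell_bound p (x + z))).1
      have h2 := (abs_le.1 (ell_bound p x)).2
      have b1 : 1 * (m * gs γ 0 x) ≤ γ * (m * gs γ 0 x) := by gcongr
      have b2 : 1 * (h * gs γ' y0 x) ≤ γ' * (h * gs γ' y0 x) := by gcongr
      simp only [tf]
      linarith [norm_nonneg p]
  -- drift term
  have hD : ‖gradient (tf m γ p h γ' y0 c) x‖ ≤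
      4 * (γ * (m * gs γ 0 x)) + ‖p‖ + 4 * (γ' * (h * gs γ' y0 x)) := by
    rw [hgrad, tfV]
    refine (norm_add_le _ _).trans ((add_le_add (norm_add_le _ _) le_rfl).trans ?_)
    rw [norm_smul, norm_smul, Real.norm_eq_abs, Real.norm_eq_abs, sub_zero]
    have e1 : |m * (-(2 * γ)) * gs γ 0 x| = 2 * (γ * (m * gs γ 0 x)) := by
      rw [show m * (-(2 * γ)) * gs γ 0 x = -(2 * (γ * (m * gs γ 0 x))) by ring, abs_neg,
        abs_of_nonneg (by positivity)]
    have e2 : |h * (-(2 * γ')) * gs γ' y0 x| = 2 * (γ' * (h * gs γ' y0 x)) := by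
      rw [show h * (-(2 * γ')) * gs γ' y0 x = -(2 * (γ' * (h * gs γ' y0 x))) by ring, abs_neg,
        abs_of_nonneg (by positivity)]
    rw [e1, e2]
    have b1 : 2 * (γ * (m * gs γ 0 x)) * ‖x‖ ≤ 2 * (γ * (m * gs γ 0 x)) * 2 := by
      gcongr; linarith
    have b2 : 2 * (γ' * (h * gs γ' y0 x)) * ‖x - y0‖ ≤ 2 * (γ' * (h * gs γ' y0 x)) * 2 := by
      gcongr
    linarith
  have hD2 : C0 * r * ‖gradient (tf m γ p h γ' y0 c) x‖ ≤ C0 * (9 * Real.sqrt d) *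
      (4 * (γ * (m * gs γ 0 x)) + ‖p‖ + 4 * (γ' * (h * gs γ' y0 x))) := by
    gcongr
  rw [sub_zero] at hP
  nlinarith [H, hP, hN, hD2]

/-- The sliding family of test functions. -/
def ps {d : ℕ} (m β : ℝ) (p y : Ed d) : ℝ := m * gs β 0 y + ell p y

lemma gs_cont {d : ℕ} (γ : ℝ) (y0 : Ed d) : Continuous (gs γ y0) := (gs_contDiff γ y0).continuous

lemma ps_cont {d : ℕ} (m β : ℝ) (p : Ed d) : Continuous (ps m β p) := by
  unfold ps
  exact (continuous_const.mul (gs_cont β 0)).add (ell_contDiff p).continuous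

lemma gs_ge {d : ℕ} {γ R : ℝ} (hγ : 0 ≤ γ) {y0 y : Ed d} (h : ‖y - y0‖ ≤ R) :
    Real.exp (-(γ * R ^ 2)) ≤ gs γ y0 y := by
  unfold gs; gcongr

lemma gs_le {d : ℕ} {γ R : ℝ} (hγ : 0 ≤ γ) {y0 y : Ed d} (hR : 0 ≤ R) (h : R ≤ ‖y - y0‖) :
    gs γ y0 y ≤ Real.exp (-(γ * R ^ 2)) := by
  unfold gs; gcongr

lemma slope_est {d : ℕ} {lam C1 Cl : ℝ} {f u : Ed d → ℝ} (hlsc : LowerSemicontinuous u)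
    (hT : ∀ (m γ : ℝ) (p : Ed d) (h γ' : ℝ) (y0 : Ed d) (c : ℝ) (x : Ed d),
        0 ≤ m → 0 ≤ h → 1 ≤ γ → 1 ≤ γ' → ‖x‖ < 3 / 4 → ‖x - y0‖ ≤ 2 →
        (∀ y, tf m γ p h γ' y0 c y ≤ u y) → u x = tf m γ p h γ' y0 c x →
        f x ≤ -(m * gs γ 0 x * γ * (4 * lam * γ * ‖x‖ ^ 2 - C1)) -
          h * gs γ' y0 x * γ' * (4 * lam * γ' * ‖x - y0‖ ^ 2 - C1) + Cl * ‖p‖)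
    (hlam : 0 < lam) {b m β t : ℝ} (hb : 1 ≤ b) (hbC : C1 + 1 ≤ 4 * lam * b) (hm : 0 ≤ m) (hβ : 1 ≤ β)
    (ht : 0 < t) (ht' : t ≤ 1 / 32) {xa xb pa pb : Ed d} (hxa : ‖xa‖ ≤ 1 / 2)
    (hca : ∀ y, u xa - ps m β pa xa ≤ u y - ps m β pa y)
    (hcb : ∀ y, u xb - ps m β pb xb ≤ u y - ps m β pb y)
    (hab : ‖xa - xb‖ ≤ t) (hne : pb ≠ pa) :
    ∃ x1, ‖x1 - xa‖ ≤ 7 * t ∧ ‖pb - pa‖ * (Real.exp (-(16 * b)) * b) ≤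
      t * (-f x1 - m * gs β 0 x1 * β * (4 * lam * β * ‖x1‖ ^ 2 - C1) + Cl * ‖pa‖) := by
  set q := pb - pa with hq
  have hq0 : 0 < ‖q‖ := norm_pos_iff.2 (sub_ne_zero.2 hne)
  set y0 : Ed d := xa + (3 * t / ‖q‖) • q with hy0
  set h := ‖q‖ * t with hh
  have hhpos : 0 < h := by positivity
  set γ := b / t ^ 2 with hγ
  have hγt : γ * t ^ 2 = b := by rw [hγ]; field_simp
  have hγ1 : 1 ≤ γ := by
    rw [hγ, le_div_iff₀ (by positivity)]; nlinarith
  have hxay : ‖xa - y0‖ = 3 * t := by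
    rw [hy0, sub_add_cancel_left, norm_neg, norm_smul, Real.norm_eq_abs,
      abs_of_pos (by positivity)]
    field_simp
  set F : Ed d → ℝ := fun y => u y + -(ps m β pa y + h * gs γ y0 y) with hF
  have hFl : LowerSemicontinuous F := hlsc.add
    (((ps_cont m β pa).add (continuous_const.mul (gs_cont γ y0))).neg.lowerSemicontinuous)
  have hxamem : xa ∈ Metric.closedBall y0 (4 * t) := by
    rw [mem_closedBall_iff_norm, hxay]; linarith
  obtain ⟨x1, hx1m, hx1⟩ := (hFl.lowerSemicontinuousOn _).exists_isMinOn ⟨xa, hxamem⟩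
    (isCompact_closedBall y0 (4 * t))
  rw [mem_closedBall_iff_norm] at hx1m
  have hx1a : F x1 ≤ F xa := hx1 hxamem
  have hga : Real.exp (-(9 * b)) ≤ gs γ y0 xa := by
    have := gs_ge (γ := γ) (by linarith) hxay.le
    rwa [show γ * (3 * t) ^ 2 = 9 * b by rw [← hγt]; ring] at this
  have hFa : F xa ≤ (u xa - ps m β pa xa) - h * Real.exp (-(9 * b)) := by
    simp only [hF]
    have := mul_le_mul_of_nonneg_left hga hhpos.le
    linarith
  have h916 : Real.exp (-(16 * b)) < Real.exp (-(9 * b)) := Real.exp_lt_exp.2 (by linarith)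
  have hglob : ∀ y, F x1 ≤ F y := by
    intro y
    by_cases hy : ‖y - y0‖ ≤ 4 * t
    · exact hx1 (mem_closedBall_iff_norm.2 hy)
    · push Not at hy
      have := gs_le (γ := γ) (by linarith) (by positivity) hy.le
      rw [show γ * (4 * t) ^ 2 = 16 * b by rw [← hγt]; ring] at this
      have h2 := mul_le_mul_of_nonneg_left (this.trans h916.le) hhpos.le
      have h3 := hca y
      simp only [hF] at hx1a hFa ⊢
      linarith
  have hx1t : t ≤ ‖x1 - y0‖ := by
    by_contra hlt
    push Not at hlt
    have hx1n : ‖x1‖ ≤ 1 := by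
      have e : x1 = (x1 - y0) - (xa - y0) + xa := by abel
      rw [e]
      refine (norm_add_le _ _).trans ((add_le_add (norm_sub_le _ _) le_rfl).trans ?_)
      rw [hxay]; linarith
    have hxbn : ‖xb‖ ≤ 1 := by
      have e : xb = xa - (xa - xb) := by abel
      rw [e]
      refine (norm_sub_le _ _).trans ?_
      linarith
    have h3 := hcb x1
    have h4 := hca xb
    have hg1 := gs_le_one (γ := γ) (by linarith) y0 x1
    have hinner : h ≤ ⟪q, x1 - xb⟫ := by
      have e : x1 - xb = (x1 - y0) + (3 * t / ‖q‖) • q + (xa - xb) := by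
        rw [hy0]; abel
      rw [e, inner_add_right, inner_add_right, real_inner_smul_right, real_inner_self_eq_norm_sq]
      have i1 := (abs_le.1 (abs_real_inner_le_norm q (x1 - y0))).1
      have i2 := (abs_le.1 (abs_real_inner_le_norm q (xa - xb))).1
      have i3 : 3 * t / ‖q‖ * ‖q‖ ^ 2 = 3 * (‖q‖ * t) := by field_simp
      have i4 : ‖q‖ * ‖x1 - y0‖ ≤ ‖q‖ * t := by gcongr
      have i5 : ‖q‖ * ‖xa - xb‖ ≤ ‖q‖ * t := by gcongr
      rw [i3]; linarith
    have hFneg : 0 < h * Real.exp (-(9 * b)) := by positivity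
    have h6 : h * gs γ y0 x1 ≤ h := mul_le_of_le_one_right hhpos.le hg1
    simp only [hF] at hx1a hFa
    simp only [ps, ell_eq _ hx1n, ell_eq _ hxbn] at hx1a hFa h3 h4
    rw [hq, inner_sub_right, inner_sub_left, inner_sub_left] at hinner
    linarith
  have hx1xa : ‖x1 - xa‖ ≤ 7 * t := by
    have e : x1 - xa = (x1 - y0) - (xa - y0) := by abel
    rw [e]
    refine (norm_sub_le _ _).trans ?_
    rw [hxay]; linarith
  refine ⟨x1, hx1xa, ?_⟩
  have hx1n : ‖x1‖ < 3 / 4 := by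
    have e : x1 = (x1 - xa) + xa := by abel
    rw [e]
    refine (norm_add_le _ _).trans_lt ?_
    linarith
  have H := hT m β pa h γ y0 (F x1) x1 hm hhpos.le hβ hγ1 hx1n (by linarith) (by
      intro y
      have := hglob y
      simp only [hF, tf, ps] at this ⊢
      linarith) (by simp only [hF, tf, ps]; ring)
  have hg16 : Real.exp (-(16 * b)) ≤ gs γ y0 x1 := by
    have := gs_ge (γ := γ) (by linarith) hx1m
    rwa [show γ * (4 * t) ^ 2 = 16 * b by rw [← hγt]; ring] at this
  have hfac : 1 ≤ 4 * lam * γ * ‖x1 - y0‖ ^ 2 - C1 := by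
    have : 4 * lam * γ * t ^ 2 ≤ 4 * lam * γ * ‖x1 - y0‖ ^ 2 := by gcongr
    rw [mul_assoc, hγt] at this
    linarith
  have hlow : h * Real.exp (-(16 * b)) * γ * 1 ≤
      h * gs γ y0 x1 * γ * (4 * lam * γ * ‖x1 - y0‖ ^ 2 - C1) := by
    have := gs_pos γ y0 x1
    gcongr
  have hfin : ‖q‖ * (Real.exp (-(16 * b)) * b) = t * (h * Real.exp (-(16 * b)) * γ * 1) := by
    rw [hh, ← hγt]; ring
  rw [hfin]
  gcongr
  linarith

/-- grid cell -/
def cell {d : ℕ} (s : ℝ) (k : Fin d → ℤ) : Set (Ed d) := {x | ∀ i, ⌊x i / s⌋ = k i}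

lemma cell_eq {d : ℕ} {s : ℝ} (hs : 0 < s) (k : Fin d → ℤ) :
    cell s k = (WithLp.ofLp : Ed d → (Fin d → ℝ)) ⁻¹'
      (Set.univ.pi fun i => Set.Ico (s * k i) (s * k i + s)) := by
  ext x
  simp only [cell, mem_ofPred_eq, mem_preimage, mem_univ_pi, mem_Ico]
  refine forall_congr' fun i => ?_
  rw [Int.floor_eq_iff, le_div_iff₀ hs, div_lt_iff₀ hs]
  constructor <;> rintro ⟨h1, h2⟩ <;> constructor <;> linarith

lemma cell_measurable {d : ℕ} {s : ℝ} (hs : 0 < s) (k : Fin d → ℤ) :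
    MeasurableSet (cell s k) := by
  rw [cell_eq hs]
  exact (PiLp.volume_preserving_ofLp (Fin d)).measurable
    (MeasurableSet.univ_pi fun i => measurableSet_Ico)

lemma cell_volume {d : ℕ} {s : ℝ} (hs : 0 < s) (k : Fin d → ℤ) :
    volume (cell s k) = ENNReal.ofReal (s ^ d) := by
  rw [cell_eq hs, (PiLp.volume_preserving_ofLp (Fin d)).measure_preimage
    (MeasurableSet.univ_pi fun i => measurableSet_Ico).nullMeasurableSet, Real.volume_pi_Ico]
  simp [ENNReal.ofReal_pow hs.le]

lemma norm_le_of_coord {d : ℕ} {s : ℝ} (hs : 0 ≤ s) (x : Ed d) (h : ∀ i, |x i| ≤ s) :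
    ‖x‖ ≤ s * Real.sqrt d := by
  rw [EuclideanSpace.norm_eq]
  calc Real.sqrt (∑ i, ‖x i‖ ^ 2) ≤ Real.sqrt (∑ _i : Fin d, s ^ 2) := by
        apply Real.sqrt_le_sqrt
        refine Finset.sum_le_sum fun i _ => ?_
        rw [Real.norm_eq_abs]
        have := h i
        gcongr
    _ = s * Real.sqrt d := by
        simp only [Finset.sum_const, Finset.card_univ, Fintype.card_fin, nsmul_eq_mul]
        rw [mul_comm, Real.sqrt_mul (by positivity), Real.sqrt_sq hs]

lemma cell_diam {d : ℕ} {s : ℝ} (hs : 0 < s) (k : Fin d → ℤ) {x y : Ed d} (hx : x ∈ cell s k)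
    (hy : y ∈ cell s k) : ‖x - y‖ ≤ s * Real.sqrt d := by
  apply norm_le_of_coord hs.le
  intro i
  rw [cell_eq hs] at hx hy
  have h1 := hx i (mem_univ i)
  have h2 := hy i (mem_univ i)
  simp only [mem_Ico] at h1 h2
  rw [PiLp.sub_apply, abs_le]
  constructor <;> linarith [h1.1, h1.2, h2.1, h2.2]

lemma cover_meas {d : ℕ} (X : Ed d → Ed d) (P : Set (Ed d)) {s : ℝ} (hs : 0 < s)
    (ν : Measure (Ed d)) (H : ∀ k : Fin d → ℤ, volume (P ∩ X ⁻¹' (cell s k)) ≤ ν (cell s k)) :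
    volume P ≤ ν univ := by
  have hc : ∀ x : Ed d, ∃ k : Fin d → ℤ, x ∈ cell s k := fun x => ⟨fun i => ⌊x i / s⌋, fun i => rfl⟩
  have hsub : P ⊆ ⋃ k : Fin d → ℤ, P ∩ X ⁻¹' (cell s k) := by
    intro p hp
    obtain ⟨k, hk⟩ := hc (X p)
    exact mem_iUnion.2 ⟨k, hp, hk⟩
  calc volume P ≤ volume (⋃ k : Fin d → ℤ, P ∩ X ⁻¹' (cell s k)) := measure_mono hsub
    _ ≤ ∑' k : Fin d → ℤ, volume (P ∩ X ⁻¹' (cell s k)) := measure_iUnion_le _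
    _ ≤ ∑' k : Fin d → ℤ, ν (cell s k) := ENNReal.tsum_le_tsum H
    _ = ν (⋃ k : Fin d → ℤ, cell s k) := by
        rw [measure_iUnion _ (fun k => cell_measurable hs k)]
        intro k l hkl
        rw [Function.onFun, Set.disjoint_left]
        intro x hx hy
        exact hkl (funext fun i => (hx i).symm.trans (hy i))
    _ ≤ ν univ := measure_mono (subset_univ _)

lemma cover_est {d : ℕ} (hd : 1 ≤ d) (X : Ed d → Ed d) (f : Ed d → ℝ) {δ E M1 η ρ s t : ℝ}
    (Γ : Set (Ed d)) (hs : 0 < s) (hst : t = s * Real.sqrt d) (ht : t ≤ 1 / 32)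
    (hE : 0 < E) (hM1 : 0 ≤ M1) (hη : 0 ≤ η)
    (hX : ∀ p ∈ Metric.closedBall (0 : Ed d) δ, ‖X p‖ ≤ 1 / 2)
    (hΓ : ∀ p ∈ Metric.closedBall (0 : Ed d) δ, ‖X p‖ ≤ ρ → X p ∈ Γ)
    (hf : ∀ x y : Ed d, ‖x‖ ≤ 3 / 4 → ‖y‖ ≤ 3 / 4 → ‖x - y‖ ≤ t → |f x - f y| ≤ η)
    (hS : ∀ pa ∈ Metric.closedBall (0 : Ed d) δ, ∀ pb ∈ Metric.closedBall (0 : Ed d) δ,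
      ‖X pa - X pb‖ ≤ t → ‖pb - pa‖ * E ≤
        t * (|f (X pa)| + η + if ‖X pa‖ ≤ ρ then M1 else 0)) :
    volume (Metric.closedBall (0 : Ed d) δ) ≤
      ENNReal.ofReal ((Real.sqrt d / E) ^ d * (volume (Metric.ball (0 : Ed d) 1)).toReal * 4 ^ d) *
        ((∫⁻ x in Metric.ball (0 : Ed d) 1, ENNReal.ofReal (|f x| ^ d)) +
          ENNReal.ofReal ((2 * η) ^ d) * volume (Metric.ball (0 : Ed d) 1)) +
      ENNReal.ofReal ((Real.sqrt d / E) ^ d * (volume (Metric.ball (0 : Ed d) 1)).toReal * 2 ^ d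
        * M1 ^ d) * volume (Metric.cthickening t Γ) := by
  set ω := (volume (Metric.ball (0 : Ed d) 1)).toReal with hω
  have hωe : volume (Metric.ball (0 : Ed d) 1) = ENNReal.ofReal ω :=
    (ENNReal.ofReal_toReal measure_ball_lt_top.ne).symm
  have hω0 : 0 ≤ ω := ENNReal.toReal_nonneg
  set D := (Real.sqrt d / E) ^ d * ω with hD
  have hD0 : 0 ≤ D := by positivity
  set ν : Measure (Ed d) :=
    (volume.restrict (Metric.ball (0 : Ed d) 1)).withDensity
      (fun x => ENNReal.ofReal (D * 4 ^ d) *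
        (ENNReal.ofReal (|f x| ^ d) + ENNReal.ofReal ((2 * η) ^ d))) +
    ENNReal.ofReal (D * 2 ^ d * M1 ^ d) • volume.restrict (Metric.cthickening t Γ) with hν
  have main : volume (Metric.closedBall (0 : Ed d) δ) ≤ ν univ := by
    refine cover_meas X _ hs ν fun k => ?_
    rcases (Metric.closedBall (0 : Ed d) δ ∩ X ⁻¹' (cell s k)).eq_empty_or_nonempty with he | hne
    · rw [he]; simp
    obtain ⟨pa, hpa, hXa⟩ := hne
    have hXa : X pa ∈ cell s k := hXa
    set κ := |f (X pa)| + η + if ‖X pa‖ ≤ ρ then M1 else 0 with hκ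
    have hκ0 : 0 ≤ κ := by
      have : (0 : ℝ) ≤ if ‖X pa‖ ≤ ρ then M1 else 0 := by split_ifs <;> simp [hM1]
      positivity
    have ht0 : 0 ≤ t := by rw [hst]; positivity
    have hsub : Metric.closedBall (0 : Ed d) δ ∩ X ⁻¹' (cell s k) ⊆
        Metric.closedBall pa (t / E * κ) := by
      rintro pb ⟨hpb, hXb⟩
      have hXb : X pb ∈ cell s k := hXb
      have h1 := hS pa hpa pb hpb (by rw [hst]; exact cell_diam hs k hXa hXb)
      rw [mem_closedBall_iff_norm, div_mul_eq_mul_div, le_div_iff₀ hE]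
      exact h1
    have hv1 : volume (Metric.closedBall (0 : Ed d) δ ∩ X ⁻¹' (cell s k)) ≤
        ENNReal.ofReal (D * κ ^ d) * volume (cell s k) := by
      refine (measure_mono hsub).trans (le_of_eq ?_)
      rw [Measure.addHaar_closedBall _ _ (by positivity), cell_volume hs, hωe,
        ← ENNReal.ofReal_mul (by positivity), ← ENNReal.ofReal_mul (by positivity)]
      congr 1
      rw [finrank_euclideanSpace_fin, hD, hst]
      rw [div_pow, mul_pow, div_pow, mul_pow]
      ring
    have hQ : ∀ x ∈ cell s k, ‖x‖ ≤ 3 / 4 ∧ |f (X pa)| ≤ |f x| + η ∧ ‖X pa - x‖ ≤ t := by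
      intro x hx
      have hdx : ‖X pa - x‖ ≤ t := by rw [hst]; exact cell_diam hs k hXa hx
      have hXn := hX pa hpa
      have hxn : ‖x‖ ≤ 3 / 4 := by
        have e : x = X pa - (X pa - x) := by abel
        rw [e]; refine (norm_sub_le _ _).trans ?_; linarith
      refine ⟨hxn, ?_, hdx⟩
      have := hf (X pa) x (by linarith) hxn hdx
      have h2 := abs_sub_abs_le_abs_sub (f (X pa)) (f x)
      linarith
    have hQsub : cell s k ⊆ Metric.ball (0 : Ed d) 1 := fun x hx => by
      rw [mem_ball_zero_iff]; linarith [(hQ x hx).1]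
    have hcm := cell_measurable hs k
    -- pointwise bound
    have hpt : ∀ x ∈ cell s k, κ ^ d ≤ 4 ^ d * (|f x| ^ d + (2 * η) ^ d) +
        if ‖X pa‖ ≤ ρ then 2 ^ d * M1 ^ d else 0 := by
      intro x hx
      have h1 := (hQ x hx).2.1
      have hfx := abs_nonneg (f x)
      have hpow : (2 : ℝ) ^ (d - 1) ≤ 2 ^ d := pow_le_pow_right₀ one_le_two (Nat.sub_le _ _)
      have hA : (|f x| + 2 * η) ^ d ≤ 2 ^ d * (|f x| ^ d + (2 * η) ^ d) :=
        (add_pow_le hfx (by positivity) d).trans (by gcongr)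
      have h24 : (4 : ℝ) ^ d = 2 ^ d * 2 ^ d := by rw [← mul_pow]; norm_num
      have h12 : (1 : ℝ) ≤ 2 ^ d := one_le_pow₀ one_le_two
      have hnn : 0 ≤ |f x| ^ d + (2 * η) ^ d := by positivity
      split_ifs with hi
      · have hk : κ ≤ (|f x| + 2 * η) + M1 := by
          rw [hκ, if_pos hi]; linarith
        calc κ ^ d ≤ ((|f x| + 2 * η) + M1) ^ d := by gcongr
          _ ≤ 2 ^ d * ((|f x| + 2 * η) ^ d + M1 ^ d) :=
            (add_pow_le (by positivity) hM1 d).trans (by gcongr)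
          _ ≤ 2 ^ d * (2 ^ d * (|f x| ^ d + (2 * η) ^ d) + M1 ^ d) := by gcongr
          _ = _ := by rw [h24]; ring
      · have hk : κ ≤ (|f x| + 2 * η) := by
          rw [hκ, if_neg hi]; linarith
        calc κ ^ d ≤ (|f x| + 2 * η) ^ d := by gcongr
          _ ≤ 1 * (2 ^ d * (|f x| ^ d + (2 * η) ^ d)) := by rw [one_mul]; exact hA
          _ ≤ 2 ^ d * (2 ^ d * (|f x| ^ d + (2 * η) ^ d)) := by gcongr
          _ = _ := by rw [h24]; ring
    set Z : ℝ := if ‖X pa‖ ≤ ρ then 2 ^ d * M1 ^ d else 0 with hZ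
    have hZ0 : 0 ≤ Z := by rw [hZ]; split_ifs <;> positivity
    have hZΓ : ENNReal.ofReal (D * Z) * volume (cell s k) ≤
        ENNReal.ofReal (D * 2 ^ d * M1 ^ d) * volume.restrict (Metric.cthickening t Γ) (cell s k) := by
      by_cases hi : ‖X pa‖ ≤ ρ
      · rw [hZ, if_pos hi, Measure.restrict_apply hcm, inter_eq_left.2, ← mul_assoc]
        intro x hx
        exact Metric.mem_cthickening_of_dist_le x (X pa) t Γ (hΓ pa hpa hi)
          (by rw [dist_comm, dist_eq_norm]; exact (hQ x hx).2.2)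
      · rw [hZ, if_neg hi]; simp
    refine hv1.trans ?_
    rw [hν, Measure.add_apply, Measure.smul_apply, smul_eq_mul, withDensity_apply _ hcm,
      Measure.restrict_restrict hcm, inter_eq_left.2 hQsub]
    refine le_trans ?_ (add_le_add le_rfl hZΓ)
    rw [← setLIntegral_const, ← setLIntegral_const, ← lintegral_add_right _ measurable_const]
    refine setLIntegral_mono' hcm fun x hx => ?_
    rw [← ENNReal.ofReal_add (by positivity) (by positivity), ← ENNReal.ofReal_mul (by positivity),
      ← ENNReal.ofReal_add (by positivity) (by positivity)]
    apply ENNReal.ofReal_le_ofReal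
    have := mul_le_mul_of_nonneg_left (hpt x hx) hD0
    linarith
  refine main.trans (le_of_eq ?_)
  rw [hν, Measure.add_apply, Measure.smul_apply, smul_eq_mul, withDensity_apply _ MeasurableSet.univ,
    Measure.restrict_univ, lintegral_const_mul' _ _ ENNReal.ofReal_ne_top,
    lintegral_add_right _ measurable_const, setLIntegral_const, Measure.restrict_apply_univ]

lemma exists_contact {d : ℕ} {u : Ed d → ℝ} (hlsc : LowerSemicontinuous u) (hu0 : ∀ x, 0 ≤ u x)
    {m β : ℝ} (hm : 0 ≤ m) (hβ : 0 ≤ β)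
    (hmβ : m * (Real.exp (-(β * (1 / 3) ^ 2)) - Real.exp (-(β * (1 / 2) ^ 2))) = 4)
    {x0 : Ed d} (hx0 : ‖x0‖ ≤ 1 / 3) (hux0 : u x0 ≤ 2) {p : Ed d} (hp : ‖p‖ ≤ 1 / 8) :
    ∃ x, ‖x‖ ≤ 1 / 2 ∧ ∀ y, u x - ps m β p x ≤ u y - ps m β p y := by
  set F : Ed d → ℝ := fun y => u y + -(ps m β p y) with hF
  have hFl : LowerSemicontinuous F := hlsc.add (ps_cont m β p).neg.lowerSemicontinuous
  have hmem : x0 ∈ Metric.closedBall (0 : Ed d) (1 / 2) := by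
    rw [mem_closedBall_zero_iff]; linarith
  obtain ⟨x, hxm, hx⟩ := (hFl.lowerSemicontinuousOn _).exists_isMinOn ⟨x0, hmem⟩
    (isCompact_closedBall (0 : Ed d) (1 / 2))
  refine ⟨x, by simpa using hxm, fun y => ?_⟩
  by_cases hy : ‖y‖ ≤ 1 / 2
  · have := hx (mem_closedBall_zero_iff.2 hy)
    simpa [hF, sub_eq_add_neg] using this
  · push Not at hy
    have h1 : F x ≤ F x0 := hx hmem
    have h2 := gs_ge (γ := β) (y0 := 0) hβ (by simpa using hx0)
    have h3 := gs_le (γ := β) (y0 := 0) (R := 1 / 2) hβ (by norm_num) (by simpa using hy.le)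
    have h4 := mul_le_mul_of_nonneg_left h2 hm
    have h5 := mul_le_mul_of_nonneg_left h3 hm
    have h6 := abs_le.1 (ell_bound p x0)
    have h7 := abs_le.1 (ell_bound p y)
    have h8 := hu0 y
    simp only [hF, ps] at h1 ⊢
    linarith [h6.1, h6.2, h7.1, h7.2]

lemma contact_compact {d : ℕ} {u : Ed d → ℝ} (hlsc : LowerSemicontinuous u) (m β δ ρ : ℝ) :
    IsCompact {x : Ed d | ‖x‖ ≤ ρ ∧ ∃ p, ‖p‖ ≤ δ ∧ ∀ y, u x - ps m β p x ≤ u y - ps m β p y} := by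
  have hcl : IsClosed {q : Ed d × Ed d | ∀ y, u q.1 - ps m β q.2 q.1 ≤ u y - ps m β q.2 y} := by
    rw [show {q : Ed d × Ed d | ∀ y, u q.1 - ps m β q.2 q.1 ≤ u y - ps m β q.2 y} =
      ⋂ y, {q : Ed d × Ed d | u q.1 - ps m β q.2 q.1 ≤ u y - ps m β q.2 y} by ext; simp]
    refine isClosed_iInter fun y => ?_
    have hl : LowerSemicontinuous (fun q : Ed d × Ed d =>
        u q.1 + (-(ps m β q.2 q.1) + ps m β q.2 y)) := by
      refine (hlsc.comp continuous_fst).add (Continuous.lowerSemicontinuous ?_)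
      unfold ps
      have c1 : Continuous (fun q : Ed d × Ed d => ell q.2 q.1) :=
        ell_cont.comp (continuous_snd.prodMk continuous_fst)
      have c2 : Continuous (fun q : Ed d × Ed d => ell q.2 y) :=
        ell_cont.comp (continuous_snd.prodMk continuous_const)
      have c3 : Continuous (fun q : Ed d × Ed d => gs β 0 q.1) := (gs_cont β 0).comp continuous_fst
      fun_prop
    have := lowerSemicontinuous_iff_isClosed_preimage.1 hl (u y)
    convert this using 1
    ext q
    simp only [mem_ofPred_eq, mem_preimage, mem_Iic]
    constructor <;> intro h <;> linarith
  have hc := ((isCompact_closedBall (0 : Ed d) ρ).prod (isCompact_closedBall (0 : Ed d) δ)).inter_right hcl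
  have hi := hc.image continuous_fst
  refine (congrArg IsCompact ?_).mpr hi
  ext x
  constructor
  · rintro ⟨h1, p, h2, h3⟩
    exact ⟨(x, p), ⟨⟨by simpa using h1, by simpa using h2⟩, h3⟩, rfl⟩
  · rintro ⟨⟨x', p⟩, ⟨⟨h1, h2⟩, h3⟩, rfl⟩
    exact ⟨by simpa using h1, p, by simpa using h2, h3⟩

lemma contact_GSet {d : ℕ} {u : Ed d → ℝ} (hu0 : ∀ x, 0 ≤ u x) {m β : ℝ} (hm : 0 ≤ m) (hβ : 0 ≤ β)
    {x0 : Ed d} (hux0 : u x0 ≤ 2) {x p : Ed d} (hp : ‖p‖ ≤ 1 / 8)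
    (hx : ‖x‖ ≤ 1 / 2) (hc : ∀ y, u x - ps m β p x ≤ u y - ps m β p y) :
    x ∈ GSet u (4 + m + 4 * m * β) := by
  have hg := gs_pos β 0 x
  have hg1 := gs_le_one hβ 0 x
  have hmg : m * β * gs β 0 x ≤ m * β := mul_le_of_le_one_right (by positivity) hg1
  refine ⟨1 / 2, by norm_num, u x, 2 * (m * β * gs β 0 x), p - (2 * (m * β * gs β 0 x)) • x, ?_, rfl, ?_⟩
  · have h1 : u x ≤ 3 + m := by
      have h := hc x0
      have h6 := abs_le.1 (ell_bound p x0)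
      have h7 := abs_le.1 (ell_bound p x)
      have h8 : 0 ≤ m * gs β 0 x0 := mul_nonneg hm (gs_pos _ _ _).le
      have h9 : m * gs β 0 x ≤ m := mul_le_of_le_one_right hm hg1
      simp only [ps] at h
      linarith [h6.1, h6.2, h7.1, h7.2]
    have h2 : ‖p - (2 * (m * β * gs β 0 x)) • x‖ ≤ 1 / 8 + (2 * (m * β)) * (1 / 2) := by
      refine (norm_sub_le _ _).trans ?_
      rw [norm_smul, Real.norm_eq_abs, abs_of_nonneg (by positivity)]
      gcongr
    rw [abs_of_nonneg (hu0 x), abs_of_nonneg (by positivity : 0 ≤ 2 * (m * β * gs β 0 x))]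
    have : 0 ≤ m * β := by positivity
    linarith
  · intro y hy
    have hyx : ‖y - x‖ < 1 / 2 := by simpa [dist_eq_norm] using hy
    have hyn : ‖y‖ ≤ 1 := by
      have e : y = (y - x) + x := by abel
      rw [e]; refine (norm_add_le _ _).trans ?_; linarith
    have h := hc y
    have hl := mul_le_mul_of_nonneg_left (gs_lower β 0 x (y - x)) hm
    rw [add_sub_cancel, sub_zero] at hl
    simp only [ps, ell_eq p hyn, ell_eq p (show ‖x‖ ≤ 1 by linarith)] at h
    rw [inner_sub_left, real_inner_smul_left, inner_sub_right p]
    linarith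

lemma exists_small_pow {d : ℕ} (hd : 1 ≤ d) {c V : ℝ} (hc : 0 ≤ c) (hV : 0 < V) :
    ∃ ε : ℝ, 0 < ε ∧ c * ε ^ d ≤ V := by
  refine ⟨min 1 (V / (c + 1)), by positivity, ?_⟩
  have h1 : (min 1 (V / (c + 1))) ^ d ≤ min 1 (V / (c + 1)) :=
    pow_le_of_le_one (by positivity) (min_le_left _ _) (by omega)
  have h2 : min 1 (V / (c + 1)) ≤ V / (c + 1) := min_le_right _ _
  calc _ ≤ c * (V / (c + 1)) := by gcongr; exact h1.trans h2
    _ ≤ (c + 1) * (V / (c + 1)) := by gcongr; linarith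
    _ = V := by field_simp

lemma real_of_ennreal {V c1 c2 e h w g : ℝ} {I : ENNReal} (hc1 : 0 ≤ c1) (hc2 : 0 ≤ c2)
    (he : 0 ≤ e) (hh : 0 ≤ h) (hw : 0 ≤ w) (hg : 0 ≤ g) (hI : I ≤ ENNReal.ofReal e)
    (H : ENNReal.ofReal V ≤ ENNReal.ofReal c1 * (I + ENNReal.ofReal h * ENNReal.ofReal w) +
      ENNReal.ofReal c2 * ENNReal.ofReal g) :
    V ≤ c1 * (e + h * w) + c2 * g := by
  have h1 : ENNReal.ofReal V ≤ ENNReal.ofReal c1 *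
      (ENNReal.ofReal e + ENNReal.ofReal h * ENNReal.ofReal w) +
      ENNReal.ofReal c2 * ENNReal.ofReal g := H.trans (by gcongr)
  rw [← ENNReal.ofReal_mul hh, ← ENNReal.ofReal_add he (by positivity),
    ← ENNReal.ofReal_mul hc1, ← ENNReal.ofReal_mul hc2,
    ← ENNReal.ofReal_add (by positivity) (by positivity)] at h1
  exact (ENNReal.ofReal_le_ofReal_iff (by positivity)).1 h1

set_option maxHeartbeats 1600000 in
/-- measure estimate for the set of paraboloid touching points (Lemma 3.6). -/
theorem first_measure_estimate_paraboloid {d : ℕ} (hd : 1 ≤ d) (lam Lam C0 : ℝ)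
    (hlam : 0 < lam) (hLam : lam ≤ Lam) (hC0 : 0 ≤ C0)
    (K : Ed d → ℝ) (hK : KernCond K) :
    ∃ ε₀ α M : ℝ, 0 < ε₀ ∧ 0 < α ∧ 0 < M ∧
      ∀ r : ℝ, 0 < r → r ≤ 9 * Real.sqrt d →
      ∀ f : Ed d → ℝ, ContinuousOn f (Metric.ball (0 : Ed d) 1) →
        IntegrableOn (fun x => |f x| ^ (d : ℝ)) (Metric.ball (0 : Ed d) 1) →
        LnormOn (d : ℝ) (Metric.ball (0 : Ed d) 1) f ≤ ε₀ →
      ∀ u : Ed d → ℝ, LowerSemicontinuous u → IsBddFun u → (∀ x, 0 ≤ u x) →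
        SupersolExtremal lam Lam C0 r K f (Metric.ball (0 : Ed d) 1) u →
        sInf (u '' cube d (3 * (1 / (9 * Real.sqrt d)))) ≤ 1 →
        ENNReal.ofReal α * volume (cube d (1 / (9 * Real.sqrt d))) ≤
          volume (cube d (1 / (9 * Real.sqrt d)) ∩ GSet u M) := by
  classical
  obtain ⟨C1, Cl, hC1, hCl, hT⟩ := touch_ineq lam Lam C0 hlam hLam hC0 K hK
  have hd0 : (0 : ℝ) < d := by exact_mod_cast hd
  have hsd : 0 < Real.sqrt d := Real.sqrt_pos.2 hd0
  have hsd1 : 1 ≤ Real.sqrt d := Real.one_le_sqrt.2 (by exact_mod_cast hd)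
  set r0 : ℝ := 1 / (9 * Real.sqrt d) with hr0
  have hr0pos : 0 < r0 := by positivity
  have hr0s : r0 * Real.sqrt d = 1 / 9 := by rw [hr0]; field_simp
  have hr0le : r0 ≤ 1 / 9 := by nlinarith
  -- constants
  obtain ⟨b, hb, hbC⟩ : ∃ b : ℝ, 1 ≤ b ∧ C1 + 1 ≤ 4 * lam * b :=
    ⟨max 1 ((C1 + 1) / (4 * lam)), le_max_left _ _, by
      have := le_max_right 1 ((C1 + 1) / (4 * lam))
      rw [div_le_iff₀ (by positivity)] at this
      linarith⟩
  obtain ⟨β, hβ, hβC⟩ : ∃ β : ℝ, 1 ≤ β ∧ C1 + 1 ≤ 4 * lam * β * (r0 / 4) ^ 2 :=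
    ⟨max 1 ((C1 + 1) / (4 * lam * (r0 / 4) ^ 2)), le_max_left _ _, by
      have := le_max_right 1 ((C1 + 1) / (4 * lam * (r0 / 4) ^ 2))
      rw [div_le_iff₀ (by positivity)] at this
      linarith⟩
  have hexp : 0 < Real.exp (-(β * (1 / 3) ^ 2)) - Real.exp (-(β * (1 / 2) ^ 2)) := by
    rw [sub_pos]; apply Real.exp_lt_exp.2; linarith
  obtain ⟨m, hm, hmβ⟩ : ∃ m : ℝ, 0 < m ∧
      m * (Real.exp (-(β * (1 / 3) ^ 2)) - Real.exp (-(β * (1 / 2) ^ 2))) = 4 :=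
    ⟨4 / (Real.exp (-(β * (1 / 3) ^ 2)) - Real.exp (-(β * (1 / 2) ^ 2))), by positivity,
      div_mul_cancel₀ _ hexp.ne'⟩
  obtain ⟨δ, hδ, hδ8, hδC⟩ : ∃ δ : ℝ, 0 < δ ∧ δ ≤ 1 / 8 ∧ Cl * δ ≤ m * Real.exp (-β) * β := by
    refine ⟨min (1 / 8) (m * Real.exp (-β) * β / (Cl + 1)), by positivity, min_le_left _ _, ?_⟩
    have h2 := min_le_right (1 / 8) (m * Real.exp (-β) * β / (Cl + 1))
    calc _ ≤ (Cl + 1) * (m * Real.exp (-β) * β / (Cl + 1)) := by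
          gcongr; linarith
      _ = _ := by field_simp
  set M1 : ℝ := m * β * C1 + Cl * δ + 1 with hM1
  have hM1pos : 0 < M1 := by positivity
  set E : ℝ := Real.exp (-(16 * b)) * b with hE
  have hEpos : 0 < E := by positivity
  set ω : ℝ := (volume (Metric.ball (0 : Ed d) 1)).toReal with hω
  have hωe : volume (Metric.ball (0 : Ed d) 1) = ENNReal.ofReal ω :=
    (ENNReal.ofReal_toReal measure_ball_lt_top.ne).symm
  have hωpos : 0 < ω := ENNReal.toReal_pos (measure_ball_pos _ _ one_pos).ne' measure_ball_lt_top.ne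
  set c1 : ℝ := (Real.sqrt d / E) ^ d * ω * 4 ^ d with hc1
  set c2 : ℝ := (Real.sqrt d / E) ^ d * ω * 2 ^ d * M1 ^ d with hc2
  have hc1pos : 0 < c1 := by positivity
  have hc2pos : 0 < c2 := by positivity
  set V : ℝ := (volume (Metric.closedBall (0 : Ed d) δ)).toReal with hV
  have hVe : volume (Metric.closedBall (0 : Ed d) δ) = ENNReal.ofReal V :=
    (ENNReal.ofReal_toReal measure_closedBall_lt_top.ne).symm
  have hVpos : 0 < V :=
    ENNReal.toReal_pos (measure_closedBall_pos _ _ hδ).ne' measure_closedBall_lt_top.ne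
  obtain ⟨ε₀, hε₀, hε₀V⟩ := exists_small_pow hd hc1pos.le (show 0 < V / 4 by positivity)
  obtain ⟨η', hη', hη'V⟩ := exists_small_pow hd (show 0 ≤ c1 * ω by positivity)
    (show 0 < V / 4 by positivity)
  set η := η' / 2 with hη
  have hηpos : 0 < η := by positivity
  set W : ℝ := (volume (cube d r0)).toReal with hW
  have hW0 : 0 ≤ W := ENNReal.toReal_nonneg
  have hcubenorm : ∀ (ρ : ℝ) (x : Ed d), 0 ≤ ρ → x ∈ cube d ρ → ‖x‖ ≤ ρ * Real.sqrt d := by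
    intro ρ x hρ hx
    apply norm_le_of_coord hρ
    intro i
    have := hx i
    simp only [PiLp.zero_apply, sub_zero] at this
    exact this.le
  have hWe : volume (cube d r0) = ENNReal.ofReal W := by
    refine (ENNReal.ofReal_toReal (ne_top_of_le_ne_top
      (measure_closedBall_lt_top (x := (0 : Ed d)) (r := r0 * Real.sqrt d)).ne
      (measure_mono fun x hx => ?_))).symm
    rw [mem_closedBall_zero_iff]
    exact hcubenorm r0 x hr0pos.le hx
  refine ⟨ε₀, V / (2 * c2 * (W + 1)), 4 + m + 4 * m * β, hε₀, by positivity, by positivity, ?_⟩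
  intro r hr hr9 f hfc hfi hfn u hlsc hub hu0 hsup hinf
  have hTu := hT r hr hr9 f u hsup
  -- a point where u is at most 2
  obtain ⟨x0, hx0, hux0⟩ : ∃ x0 : Ed d, ‖x0‖ ≤ 1 / 3 ∧ u x0 ≤ 2 := by
    have hne : (u '' cube d (3 * r0)).Nonempty := by
      refine ⟨_, 0, ?_, rfl⟩
      intro i
      simp; positivity
    obtain ⟨_, ⟨x0, hx0, rfl⟩, hlt⟩ := exists_lt_of_csInf_lt hne (lt_of_le_of_lt hinf one_lt_two)
    refine ⟨x0, ?_, hlt.le⟩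
    have := hcubenorm _ x0 (by positivity) hx0
    linarith
  -- selection of contact points
  have hex : ∀ p : Ed d, ∃ x, ‖p‖ ≤ δ →
      (‖x‖ ≤ 1 / 2 ∧ ∀ y, u x - ps m β p x ≤ u y - ps m β p y) := by
    intro p
    by_cases hp : ‖p‖ ≤ δ
    · obtain ⟨x, hx⟩ := exists_contact hlsc hu0 hm.le (by linarith) hmβ hx0 hux0 (hp.trans hδ8)
      exact ⟨x, fun _ => hx⟩
    · exact ⟨0, fun h => absurd h hp⟩
  choose X hX using hex
  set Γ : Set (Ed d) := {x : Ed d | ‖x‖ ≤ r0 / 2 ∧ ∃ p, ‖p‖ ≤ δ ∧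
    ∀ y, u x - ps m β p x ≤ u y - ps m β p y} with hΓ
  have hΓc : IsCompact Γ := contact_compact hlsc m β δ (r0 / 2)
  have hΓsub : Γ ⊆ cube d r0 ∩ GSet u (4 + m + 4 * m * β) := by
    rintro x ⟨hx, p, hp, hc⟩
    refine ⟨fun i => ?_, contact_GSet hu0 hm.le (by linarith) hux0 (hp.trans hδ8) (by linarith) hc⟩
    have h1 := PiLp.norm_apply_le x i
    rw [Real.norm_eq_abs] at h1
    simp only [PiLp.zero_apply, sub_zero]
    linarith
  -- uniform continuity of f
  have hfuc : UniformContinuousOn f (Metric.closedBall (0 : Ed d) (3 / 4)) :=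
    (isCompact_closedBall _ _).uniformContinuousOn_of_continuous
      (hfc.mono (Metric.closedBall_subset_ball (by norm_num)))
  obtain ⟨τ, hτ, hτf⟩ := Metric.uniformContinuousOn_iff.1 hfuc η hηpos
  have hfη : ∀ x y : Ed d, ‖x‖ ≤ 3 / 4 → ‖y‖ ≤ 3 / 4 → ‖x - y‖ < τ → |f x - f y| ≤ η := by
    intro x y hx hy hxy
    have := hτf x (by simpa using hx) y (by simpa using hy) (by rwa [dist_eq_norm])
    rw [Real.dist_eq] at this
    exact this.le
  -- integral of f
  set I : ENNReal := ∫⁻ x in Metric.ball (0 : Ed d) 1, ENNReal.ofReal (|f x| ^ d) with hI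
  have hIle : I ≤ ENNReal.ofReal (ε₀ ^ d) := by
    have hfi' : IntegrableOn (fun x => |f x| ^ d) (Metric.ball (0 : Ed d) 1) := by
      simpa only [Real.rpow_natCast] using hfi
    rw [hI, ← ofReal_integral_eq_lintegral_ofReal hfi'
      (Filter.Eventually.of_forall fun x => by positivity)]
    apply ENNReal.ofReal_le_ofReal
    have h0 : 0 ≤ ∫ x in Metric.ball (0 : Ed d) 1, |f x| ^ d :=
      integral_nonneg fun x => by positivity
    simp only [LnormOn, Real.rpow_natCast] at hfn
    calc _ = ((∫ x in Metric.ball (0 : Ed d) 1, |f x| ^ d) ^ (1 / (d : ℝ))) ^ d := by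
          rw [one_div, Real.rpow_inv_natCast_pow h0 (by omega)]
      _ ≤ ε₀ ^ d := by gcongr
  -- estimate at scale t
  have hscale : ∀ t : ℝ, 0 < t → t < min (1 / 32) (min (τ / 8) (r0 / 32)) →
      ENNReal.ofReal V ≤ ENNReal.ofReal c1 * (I + ENNReal.ofReal ((2 * η) ^ d) * ENNReal.ofReal ω) +
        ENNReal.ofReal c2 * volume (Metric.cthickening t Γ) := by
    intro t ht htm
    have ht1 : t < 1 / 32 := htm.trans_le (min_le_left _ _)
    have ht2 : t < τ / 8 := htm.trans_le ((min_le_right _ _).trans (min_le_left _ _))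
    have ht3 : t < r0 / 32 := htm.trans_le ((min_le_right _ _).trans (min_le_right _ _))
    rw [← hVe, ← hωe]
    refine cover_est hd X f (ρ := r0 / 2) (s := t / Real.sqrt d) Γ (by positivity)
      (by field_simp) ht1.le hEpos hM1pos.le hηpos.le ?_ ?_ ?_ ?_
    · intro p hp
      exact (hX p (by simpa using hp)).1
    · intro p hp hρ
      exact ⟨hρ, p, by simpa using hp, (hX p (by simpa using hp)).2⟩
    · intro x y hx hy hxy
      exact hfη x y hx hy (by linarith)
    · intro pa hpa pb hpb hab
      have hpa : ‖pa‖ ≤ δ := by simpa using hpa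
      have hpb : ‖pb‖ ≤ δ := by simpa using hpb
      have hif : (0 : ℝ) ≤ if ‖X pa‖ ≤ r0 / 2 then M1 else 0 := by
        split_ifs
        · exact hM1pos.le
        · exact le_rfl
      by_cases hne : pb = pa
      · rw [hne, sub_self, norm_zero, zero_mul]
        positivity
      obtain ⟨x1, hx1, hest⟩ := slope_est hlsc hTu hlam hb hbC hm.le hβ ht ht1.le (hX pa hpa).1
        (hX pa hpa).2 (hX pb hpb).2 hab hne
      refine hest.trans ?_
      have hXa := (hX pa hpa).1
      have hx1n : ‖x1‖ ≤ 3 / 4 := by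
        have e : x1 = (x1 - X pa) + X pa := by abel
        rw [e]; refine (norm_add_le _ _).trans ?_; linarith
      have hfx : -f x1 ≤ |f (X pa)| + η := by
        have h1 := hfη x1 (X pa) hx1n (by linarith) (by linarith)
        have h2 := abs_sub_abs_le_abs_sub (f x1) (f (X pa))
        have h3 := neg_abs_le (f x1)
        linarith
      have hClp : Cl * ‖pa‖ ≤ Cl * δ := by gcongr
      have hg := gs_pos β 0 x1
      have hg1 := gs_le_one (γ := β) (by linarith) 0 x1
      have hbar : -(m * gs β 0 x1 * β * (4 * lam * β * ‖x1‖ ^ 2 - C1)) + Cl * ‖pa‖ ≤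
          if ‖X pa‖ ≤ r0 / 2 then M1 else 0 := by
        split_ifs with hi
        · have k1 : m * gs β 0 x1 * β * C1 ≤ m * 1 * β * C1 := by gcongr
          have k2 : 0 ≤ m * gs β 0 x1 * β * (4 * lam * β * ‖x1‖ ^ 2) := by positivity
          rw [hM1]
          linarith
        · push Not at hi
          have hx1r : r0 / 4 ≤ ‖x1‖ := by
            have h1 := norm_sub_norm_le (X pa) x1
            rw [norm_sub_rev] at h1
            linarith
          have k1 : 4 * lam * β * (r0 / 4) ^ 2 ≤ 4 * lam * β * ‖x1‖ ^ 2 := by gcongr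
          have k2 : Real.exp (-β) ≤ gs β 0 x1 := by
            have := gs_ge (γ := β) (R := 1) (y0 := 0) (y := x1) (by linarith)
              (by rw [sub_zero]; linarith)
            simpa using this
          have k3 : m * Real.exp (-β) * β * 1 ≤
              m * gs β 0 x1 * β * (4 * lam * β * ‖x1‖ ^ 2 - C1) := by
            gcongr
            linarith
          linarith
      refine mul_le_mul_of_nonneg_left ?_ ht.le
      linarith
  -- pass to the limit
  have hlim : ENNReal.ofReal V ≤
      ENNReal.ofReal c1 * (I + ENNReal.ofReal ((2 * η) ^ d) * ENNReal.ofReal ω) +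
        ENNReal.ofReal c2 * volume Γ := by
    have ht : Filter.Tendsto (fun t => ENNReal.ofReal c1 *
        (I + ENNReal.ofReal ((2 * η) ^ d) * ENNReal.ofReal ω) +
        ENNReal.ofReal c2 * volume (Metric.cthickening t Γ)) (nhdsWithin 0 (Set.Ioi 0))
        (nhds (ENNReal.ofReal c1 * (I + ENNReal.ofReal ((2 * η) ^ d) * ENNReal.ofReal ω) +
        ENNReal.ofReal c2 * volume Γ)) := by
      refine Filter.Tendsto.const_add _ (ENNReal.Tendsto.const_mul ?_ (Or.inr ENNReal.ofReal_ne_top))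
      exact (tendsto_measure_cthickening_of_isCompact hΓc).mono_left nhdsWithin_le_nhds
    refine ge_of_tendsto ht ?_
    filter_upwards [Ioo_mem_nhdsGT (show (0 : ℝ) < min (1 / 32) (min (τ / 8) (r0 / 32)) by
      positivity)] with t htt
    exact hscale t htt.1 htt.2
  set g : ℝ := (volume Γ).toReal with hg
  have hge : volume Γ = ENNReal.ofReal g := (ENNReal.ofReal_toReal hΓc.measure_lt_top.ne).symm
  have hg0 : 0 ≤ g := ENNReal.toReal_nonneg
  have hreal : V ≤ c1 * (ε₀ ^ d + (2 * η) ^ d * ω) + c2 * g := by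
    rw [hge] at hlim
    exact real_of_ennreal hc1pos.le hc2pos.le (pow_nonneg hε₀.le d)
      (pow_nonneg (by linarith) d) hωpos.le hg0 hIle hlim
  have h2η : 2 * η = η' := by rw [hη]; ring
  rw [h2η] at hreal
  have hgV : V / (2 * c2) ≤ g := by
    rw [div_le_iff₀ (by positivity)]
    nlinarith
  refine le_trans ?_ (measure_mono hΓsub)
  rw [hWe, hge, ← ENNReal.ofReal_mul (by positivity)]
  apply ENNReal.ofReal_le_ofReal
  refine le_trans ?_ hgV
  rw [div_mul_eq_mul_div, div_le_div_iff₀ (by positivity) (by positivity)]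
  have : 0 ≤ V * (2 * c2) := by positivity
  nlinarith
end
end
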